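/- arXiv:1709.04508 — 2 statements merged into one kernel-verified Lean document; each statement's English description precedes it below -/
import Mathlib

section
/- Let n>1, let 𝔸 be a ℂ-elliptic homogeneous linear constant-coefficient differential operator of order k on ℝⁿ from V to W, let Ω ⊂ ℝⁿ be a bounded open set that is star-shaped with respect to an open ball contained in it, let 1 ≤ p ≤ ∞ and 0 ≤ l < k. Then there exists a constant c > 0 (depending on 𝔸, Ω, p, l) such that for every u ∈ C^∞(cl(Ω), V) there exists P ∈ C^∞(ℝⁿ, V) with 𝔸P = 0 on ℝⁿ and ‖D^l(u − P)‖_{L^p(Ω)} ≤ c ‖𝔸u‖_{L^p(Ω)}. -/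
noncomputable section

open MeasureTheory Metric
open scoped ENNReal RealInnerProductSpace

/-- Euclidean space `ℝⁿ`. -/
abbrev Euc (n : ℕ) : Type := EuclideanSpace ℝ (Fin n)

/-- The coefficient datum of a homogeneous `k`-th order linear constant-coefficient
differential operator `𝔸` from `V` to `W` on `ℝⁿ`: a linear map acting on the space of
(values of) `k`-th derivatives, so that `𝔸 u (x) = A (D^k u (x))`. -/
abbrev OpCoeff (n k : ℕ) (V W : Type*) [NormedAddCommGroup V] [NormedSpace ℝ V]
    [NormedAddCommGroup W] [NormedSpace ℝ W] : Type _ :=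
  ContinuousMultilinearMap ℝ (fun _ : Fin k => Euc n) V →L[ℝ] W

variable {n k : ℕ} {V W : Type*}
  [NormedAddCommGroup V] [InnerProductSpace ℝ V] [FiniteDimensional ℝ V]
  [NormedAddCommGroup W] [InnerProductSpace ℝ W] [FiniteDimensional ℝ W]

/-- `𝔸 u`, the operator applied to `u : ℝⁿ → V`. -/
def opApply (A : OpCoeff n k V W) (u : Euc n → V) (x : Euc n) : W :=
  A (iteratedFDeriv ℝ k u x)

/-- The symmetric tensor `v ⊗^k ξ`, i.e. the `k`-linear map `(e₁,…,e_k) ↦ (∏ᵢ ⟪ξ,eᵢ⟫) • v`. -/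
def symTensor (n k : ℕ) {V : Type*} [NormedAddCommGroup V] [NormedSpace ℝ V]
    (ξ : Euc n) (v : V) : ContinuousMultilinearMap ℝ (fun _ : Fin k => Euc n) V :=
  (ContinuousMultilinearMap.mkPiRing ℝ (Fin k) v).compContinuousLinearMap
    (fun _ => innerSL ℝ ξ)

/-- The (real) symbol `𝔸[ξ] v = A (v ⊗^k ξ)`. -/
def symbol (A : OpCoeff n k V W) (ξ : Euc n) (v : V) : W :=
  A (symTensor n k ξ v)

/-- Ellipticity: `𝔸[ξ]` is injective for every real `ξ ≠ 0`. -/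
def IsElliptic (A : OpCoeff n k V W) : Prop :=
  ∀ ξ : Euc n, ξ ≠ 0 → Function.Injective (symbol A ξ)

/-- Cancellation: `⋂_{ξ ≠ 0} 𝔸[ξ](V) = {0}`. -/
def IsCancelling (A : OpCoeff n k V W) : Prop :=
  (⋂ ξ ∈ {ξ : Euc n | ξ ≠ 0}, Set.range (symbol A ξ)) = {0}

/-- The scalar `ℝ`-multilinear map `(e₁,…,e_k) ↦ ∏ᵢ (⟪η₁,eᵢ⟫ + i ⟪η₂,eᵢ⟫) ∈ ℂ`,
the building block for the complexified symbol at `ξ = η₁ + i η₂`. -/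
def cxKernel (n k : ℕ) (η₁ η₂ : Euc n) :
    ContinuousMultilinearMap ℝ (fun _ : Fin k => Euc n) ℂ :=
  ((ContinuousMultilinearMap.mkPiRing ℂ (Fin k) (1 : ℂ)).restrictScalars ℝ).compContinuousLinearMap
    (fun _ => Complex.ofRealCLM.comp (innerSL ℝ η₁) + Complex.I • Complex.ofRealCLM.comp (innerSL ℝ η₂))

/-- Real part of the complexified tensor `(v₁ + i v₂) ⊗^k (η₁ + i η₂)`. -/
def cxSymTensorRe (n k : ℕ) {V : Type*} [NormedAddCommGroup V] [NormedSpace ℝ V]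
    (η₁ η₂ : Euc n) (v₁ v₂ : V) : ContinuousMultilinearMap ℝ (fun _ : Fin k => Euc n) V :=
  (Complex.reCLM.compContinuousMultilinearMap (cxKernel n k η₁ η₂)).smulRight v₁
    - (Complex.imCLM.compContinuousMultilinearMap (cxKernel n k η₁ η₂)).smulRight v₂

/-- Imaginary part of the complexified tensor `(v₁ + i v₂) ⊗^k (η₁ + i η₂)`. -/
def cxSymTensorIm (n k : ℕ) {V : Type*} [NormedAddCommGroup V] [NormedSpace ℝ V]
    (η₁ η₂ : Euc n) (v₁ v₂ : V) : ContinuousMultilinearMap ℝ (fun _ : Fin k => Euc n) V :=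
  (Complex.imCLM.compContinuousMultilinearMap (cxKernel n k η₁ η₂)).smulRight v₁
    + (Complex.reCLM.compContinuousMultilinearMap (cxKernel n k η₁ η₂)).smulRight v₂

/-- ℂ-ellipticity: the complexified symbol `𝔸[η₁ + i η₂]` is injective on `V + iV` for
every nonzero complex frequency `η₁ + i η₂`. -/
def IsCElliptic (A : OpCoeff n k V W) : Prop :=
  ∀ η₁ η₂ : Euc n, ∀ v₁ v₂ : V, (η₁, η₂) ≠ 0 →
    A (cxSymTensorRe n k η₁ η₂ v₁ v₂) = 0 → A (cxSymTensorIm n k η₁ η₂ v₁ v₂) = 0 →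
      v₁ = 0 ∧ v₂ = 0

/-- The null-space of `𝔸`: smooth maps `u : ℝⁿ → V` with `𝔸 u = 0`. -/
def nullSpace (A : OpCoeff n k V W) : Set (Euc n → V) :=
  {u | ContDiff ℝ (⊤ : ℕ∞) u ∧ ∀ x, opApply A u x = 0}

section Calc
open scoped Nat
variable {E : Type} {X Y : Type*} [NormedAddCommGroup E] [NormedSpace ℝ E]
  [NormedAddCommGroup X] [NormedSpace ℝ X] [NormedAddCommGroup Y] [NormedSpace ℝ Y]

theorem pa_smooth_iter {f : E → X} (hf : ContDiff ℝ (⊤ : ℕ∞) f) (j : ℕ) :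
    ContDiff ℝ (⊤ : ℕ∞) (iteratedFDeriv ℝ j f) :=
  hf.iteratedFDeriv_right (by exact_mod_cast le_top)

theorem pa_smooth_fderiv {f : E → X} (hf : ContDiff ℝ (⊤ : ℕ∞) f) :
    ContDiff ℝ (⊤ : ℕ∞) (fderiv ℝ f) :=
  hf.fderiv_right (by exact_mod_cast le_top)

theorem pa_smooth_apply {m : ℕ} {f : E → ContinuousMultilinearMap ℝ (fun _ : Fin m => E) X}
    (hf : ContDiff ℝ (⊤ : ℕ∞) f) (w : Fin m → E) : ContDiff ℝ (⊤ : ℕ∞) (fun y => f y w) :=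
  (ContinuousMultilinearMap.apply ℝ (fun _ : Fin m => E) X w).contDiff.comp hf

theorem pa_smooth_diff {f : E → X} (hf : ContDiff ℝ (⊤ : ℕ∞) f) : Differentiable ℝ f :=
  hf.differentiable (by simp)

theorem pa_succ {f : E → X} (hf : ContDiff ℝ (⊤ : ℕ∞) f) (m : ℕ) (x : E) (v : Fin (m + 1) → E) :
    iteratedFDeriv ℝ (m + 1) f x v =
      fderiv ℝ (fun y => iteratedFDeriv ℝ m f y (Fin.tail v)) x (v 0) :=
  DifferentiableAt.iteratedFDeriv_succ_apply_left' (pa_smooth_diff (pa_smooth_iter hf m) x)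

theorem pa_adj {f : E → X} (hf : ContDiff ℝ (⊤ : ℕ∞) f) (m : ℕ) :
    ∀ (i : Fin m) (x : E) (v : Fin (m + 1) → E),
    iteratedFDeriv ℝ (m + 1) f x (v ∘ Equiv.swap i.castSucc i.succ) =
      iteratedFDeriv ℝ (m + 1) f x v := by
  induction m with
  | zero => intro i; exact i.elim0
  | succ m ih =>
    intro i x v
    rcases Fin.eq_zero_or_eq_succ i with rfl | ⟨j, rfl⟩
    · have key : ∀ v : Fin (m + 2) → E, iteratedFDeriv ℝ (m + 2) f x v =
        fderiv ℝ (fderiv ℝ (fun z => iteratedFDeriv ℝ m f z (Fin.tail (Fin.tail v)))) x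
          (v 0) (v 1) := by
        intro v
        rw [pa_succ hf]
        have : (fun y => iteratedFDeriv ℝ (m + 1) f y (Fin.tail v)) = fun y =>
          fderiv ℝ (fun z => iteratedFDeriv ℝ m f z (Fin.tail (Fin.tail v))) y (v 1) := by
          funext y
          rw [pa_succ hf]
          rfl
        rw [this]
        have hd := pa_smooth_diff (pa_smooth_fderiv
          (pa_smooth_apply (pa_smooth_iter hf m) (Fin.tail (Fin.tail v)))) x
        rw [fderiv_clm_apply hd (differentiableAt_const _)]
        simp
      rw [key, key]
      have hs : IsSymmSndFDerivAt ℝ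
          (fun z => iteratedFDeriv ℝ m f z (Fin.tail (Fin.tail v))) x :=
        ((pa_smooth_apply (pa_smooth_iter hf m) (Fin.tail (Fin.tail v))).contDiffAt).isSymmSndFDerivAt
          (by simp only [minSmoothness_of_isRCLikeNormedField]; exact WithTop.coe_le_coe.2 (le_top : (2 : ℕ∞) ≤ ⊤))
      have e1 : Fin.tail (Fin.tail (v ∘ Equiv.swap (Fin.castSucc (0 : Fin (m + 1))) (Fin.succ 0)))
          = Fin.tail (Fin.tail v) := by
        funext i
        simp only [Fin.tail, Function.comp]
        rw [Equiv.swap_apply_of_ne_of_ne]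
        · exact Fin.succ_ne_zero _
        · intro h
          exact Fin.succ_ne_zero _ (Fin.succ_injective _ h)
      rw [e1]
      have e2 : (v ∘ Equiv.swap (Fin.castSucc (0 : Fin (m + 1))) (Fin.succ 0)) 0 = v 1 := by
        simp
      have e3 : (v ∘ Equiv.swap (Fin.castSucc (0 : Fin (m + 1))) (Fin.succ 0)) 1 = v 0 := by
        simp
      rw [e2, e3]
      exact hs _ _
    · rw [pa_succ hf, pa_succ hf]
      have e1 : Fin.tail (v ∘ Equiv.swap (Fin.castSucc j.succ) (Fin.succ j.succ)) =
          Fin.tail v ∘ Equiv.swap j.castSucc j.succ := by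
        funext i
        simp only [Fin.tail, Function.comp]
        congr 1
        simp only [Equiv.swap_apply_def, Fin.succ_inj, ← Fin.succ_castSucc]
        split_ifs <;> rfl
      have e2 : (v ∘ Equiv.swap (Fin.castSucc j.succ) (Fin.succ j.succ)) 0 = v 0 := by
        simp only [Function.comp]
        rw [Equiv.swap_apply_of_ne_of_ne]
        · rw [← Fin.succ_castSucc]; exact (Fin.succ_ne_zero _).symm
        · exact (Fin.succ_ne_zero _).symm
      rw [e1, e2]
      simp_rw [ih]

theorem pa_symm {f : E → X} (hf : ContDiff ℝ (⊤ : ℕ∞) f) (m : ℕ) (x : E) (v : Fin m → E)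
    (σ : Equiv.Perm (Fin m)) :
    iteratedFDeriv ℝ m f x (v ∘ σ) = iteratedFDeriv ℝ m f x v := by
  cases m with
  | zero => congr 1; exact Subsingleton.elim _ _
  | succ m =>
    have hσ : σ ∈ Submonoid.closure
        (Set.range fun i : Fin m ↦ Equiv.swap i.castSucc i.succ) := by
      rw [Equiv.Perm.mclosure_swap_castSucc_succ]; trivial
    induction hσ using Submonoid.closure_induction generalizing v with
    | mem s hs => obtain ⟨i, rfl⟩ := hs; exact pa_adj hf m i x v
    | one => rfl
    | mul a b _ _ ha hb =>
      have : v ∘ (a * b : Equiv.Perm _) = (v ∘ a) ∘ b := rfl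
      rw [this, hb, ha]

theorem pa_append {m : ℕ} (k : ℕ) : ∀ {X : Type _} [NormedAddCommGroup X] [NormedSpace ℝ X]
    {f : E → X} (x : E) (z : Fin m → E) (v : Fin k → E),
    iteratedFDeriv ℝ m (iteratedFDeriv ℝ k f) x z v =
      iteratedFDeriv ℝ (m + k) f x (Fin.append z v) := by
  induction k with
  | zero =>
    intro X _ _ f x z v
    have : iteratedFDeriv ℝ 0 f = (continuousMultilinearCurryFin0 ℝ E X).symm.toContinuousLinearEquiv ∘ f := by
      exact iteratedFDeriv_zero_eq_comp
    rw [this, ContinuousLinearEquiv.iteratedFDeriv_comp_left]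
    simp only [ContinuousLinearMap.compContinuousMultilinearMap_coe, Function.comp]
    have h2 : Fin.append z v = z := by
      funext i
      have := Fin.append_left z v i
      exact this
    rw [h2]
    simp
  | succ k ih =>
    intro X _ _ f x z v
    have : iteratedFDeriv ℝ (k + 1) f =
      (continuousMultilinearCurryRightEquiv' ℝ k E X).symm.toContinuousLinearEquiv ∘
          iteratedFDeriv ℝ k (fderiv ℝ f) := by
      funext y; exact iteratedFDeriv_succ_eq_comp_right
    rw [this]
    have h4 := (continuousMultilinearCurryRightEquiv' ℝ k E X).symm.toContinuousLinearEquiv.iteratedFDeriv_comp_left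
      (f := iteratedFDeriv ℝ k (fderiv ℝ f)) (x := x) (i := m)
    refine (congrArg (fun T => T z v) h4).trans ?_
    have h3 : ((continuousMultilinearCurryRightEquiv' ℝ k E X).symm
        (iteratedFDeriv ℝ m (iteratedFDeriv ℝ k (fderiv ℝ f)) x z)) v =
        iteratedFDeriv ℝ m (iteratedFDeriv ℝ k (fderiv ℝ f)) x z (Fin.init v) (v (Fin.last k)) := by
      exact continuousMultilinearCurryRightEquiv_symm_apply' ..
    refine Eq.trans h3 ?_
    rw [ih]
    show _ = iteratedFDeriv ℝ (m + k + 1) f x (Fin.append (m := m) (n := k + 1) z v)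
    rw [iteratedFDeriv_succ_apply_right]
    congr 2
    · congr 1
      funext i
      refine Fin.addCases (fun i => ?_) (fun i => ?_) i
      · rw [Fin.append_left]
        exact (Fin.append_left z v i).symm
      · rw [Fin.append_right]
        exact (Fin.append_right z v i.castSucc).symm
    · exact (Fin.append_right z v (Fin.last k)).symm

/-- Taylor polynomial of degree `< m` of `f` at `y`, evaluated at `x`. -/
def tay (m : ℕ) (f : E → X) (y x : E) : X :=
  ∑ j ∈ Finset.range m, (j ! : ℝ)⁻¹ • iteratedFDeriv ℝ j f y (fun _ => x - y)

theorem tay_clm (m : ℕ) {f : E → X} (hf : ContDiff ℝ (⊤ : ℕ∞) f) (L : X →L[ℝ] Y) (y x : E) :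
    tay m (L ∘ f) y x = L (tay m f y x) := by
  unfold tay
  rw [map_sum]
  refine Finset.sum_congr rfl fun j _ => ?_
  rw [L.iteratedFDeriv_comp_left (n := (⊤ : ℕ∞)) hf.contDiffAt (by exact_mod_cast le_top)]
  simp

theorem tay_contDiff (m : ℕ) (f : E → X) (y : E) : ContDiff ℝ (⊤ : ℕ∞) (tay m f y) := by
  unfold tay
  refine ContDiff.sum fun j _ => ContDiff.const_smul _ ?_
  exact (iteratedFDeriv ℝ j f y).contDiff.comp (contDiff_pi.2 fun _ => contDiff_id.sub contDiff_const)

theorem tay_hasFDerivAt (m : ℕ) {f : E → X} (hf : ContDiff ℝ (⊤ : ℕ∞) f) (y x : E) :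
    HasFDerivAt (tay (m + 1) f y) (tay m (fderiv ℝ f) y x) x := by
  have hterm : ∀ j : ℕ, HasFDerivAt
      (fun x => ((j + 1)! : ℝ)⁻¹ • iteratedFDeriv ℝ (j + 1) f y (fun _ => x - y))
      ((j ! : ℝ)⁻¹ • iteratedFDeriv ℝ j (fderiv ℝ f) y (fun _ => x - y)) x := by
    intro j
    have h1 := ((iteratedFDeriv ℝ (j + 1) f y).hasFDerivAt (fun _ => x - y)).comp x
      (f := fun x : E => (fun _ : Fin (j + 1) => x - y))
      (hasFDerivAt_pi.2 (fun _ => (hasFDerivAt_id x).sub_const y))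
    have h2 := h1.const_smul ((j + 1)! : ℝ)⁻¹
    refine h2.congr_fderiv ?_
    ext h
    have hsw : ∀ i : Fin (j + 1), iteratedFDeriv ℝ (j + 1) f y
        (Function.update (fun _ => x - y) i h) =
        iteratedFDeriv ℝ j (fderiv ℝ f) y (fun _ => x - y) h := by
      intro i
      rw [← pa_symm hf (j + 1) y _ (Equiv.swap i (Fin.last j)), iteratedFDeriv_succ_apply_right]
      congr 1
      · congr 2
        funext a
        simp only [Fin.init, Function.comp]
        rw [Function.update_of_ne]
        intro h
        have := (Equiv.swap_apply_eq_iff).1 h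
        rw [Equiv.swap_apply_left] at this
        exact Fin.castSucc_ne_last a this
      · simp
    simp [ContinuousMultilinearMap.linearDeriv_apply, hsw]
    rw [← Nat.cast_smul_eq_nsmul ℝ, smul_smul, Nat.factorial_succ]
    congr 1
    push_cast
    field_simp
  have h0 : (tay (m + 1) f y) = fun x => (∑ j ∈ Finset.range m, (((j + 1)! : ℝ)⁻¹ •
      iteratedFDeriv ℝ (j + 1) f y (fun _ => x - y))) + f y := by
    funext x
    unfold tay
    rw [Finset.sum_range_succ']
    simp
  rw [h0]
  unfold tay
  exact (HasFDerivAt.fun_sum fun j _ => hterm j).add_const _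

theorem tay_iter (l m : ℕ) : ∀ {X : Type _} [NormedAddCommGroup X] [NormedSpace ℝ X]
    {f : E → X} (_ : ContDiff ℝ (⊤ : ℕ∞) f) (y x : E),
    iteratedFDeriv ℝ l (tay (m + l) f y) x = tay m (iteratedFDeriv ℝ l f) y x := by
  induction l with
  | zero =>
    intro X _ _ f hf y x
    have : iteratedFDeriv ℝ 0 f = (continuousMultilinearCurryFin0 ℝ E X).symm.toContinuousLinearEquiv.toContinuousLinearMap ∘ f := by
      exact iteratedFDeriv_zero_eq_comp
    rw [this, tay_clm _ hf]
    exact congrFun iteratedFDeriv_zero_eq_comp x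
  | succ l ih =>
    intro X _ _ f hf y x
    have : iteratedFDeriv ℝ (l + 1) f =
      (continuousMultilinearCurryRightEquiv' ℝ l E X).symm.toContinuousLinearEquiv.toContinuousLinearMap ∘
          iteratedFDeriv ℝ l (fderiv ℝ f) := by
      funext y; exact iteratedFDeriv_succ_eq_comp_right
    rw [this, tay_clm _ (pa_smooth_iter (pa_smooth_fderiv hf) l), ← ih (pa_smooth_fderiv hf)]
    rw [iteratedFDeriv_succ_eq_comp_right]
    have h2 : (fun y_1 => fderiv ℝ (tay (m + (l + 1)) f y) y_1) = tay (m + l) (fderiv ℝ f) y := by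
      funext z
      exact (tay_hasFDerivAt (m + l) hf y z).fderiv
    rw [h2]
    rfl

theorem tay_continuous (m : ℕ) {f : E → X} (hf : ContDiff ℝ (⊤ : ℕ∞) f) (x : E) :
    Continuous (fun y => tay m f y x) := by
  unfold tay
  refine continuous_finsetSum _ fun j _ => Continuous.const_smul ?_ _
  have h1 := (pa_smooth_iter hf j).continuous
  exact h1.eval (continuous_pi fun _ => continuous_const.sub continuous_id)

theorem tay_congr (m : ℕ) {f g : E → X} {y : E} (h : f =ᶠ[nhds y] g) (x : E) :
    tay m f y x = tay m g y x := by
  unfold tay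
  refine Finset.sum_congr rfl fun j _ => ?_
  rw [(h.iteratedFDeriv ℝ j).self_of_nhds]

end Calc

section Alg
variable {n k : ℕ} {V W : Type*}
  [NormedAddCommGroup V] [InnerProductSpace ℝ V] [FiniteDimensional ℝ V]
  [NormedAddCommGroup W] [InnerProductSpace ℝ W] [FiniteDimensional ℝ W]

/-- counting multi-index of a tuple -/
def cnt {n d : ℕ} (t : Fin d → Fin n) : Fin n →₀ ℕ := ∑ a, Finsupp.single (t a) 1

theorem cnt_apply {n d : ℕ} (t : Fin d → Fin n) (i : Fin n) :
    cnt t i = Fintype.card {a // t a = i} := by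
  unfold cnt
  rw [Finsupp.finsetSum_apply, Fintype.card_subtype, Finset.card_filter]
  simp only [Finsupp.single_apply]

theorem cnt_perm {n d : ℕ} (t t' : Fin d → Fin n) (h : cnt t = cnt t') :
    ∃ σ : Equiv.Perm (Fin d), t = t' ∘ σ := by
  have e : ∀ i, Nonempty ({a // t a = i} ≃ {a // t' a = i}) := by
    intro i
    rw [← Fintype.card_eq, ← cnt_apply, ← cnt_apply, h]
  replace e := fun i => Classical.choice (e i)
  refine ⟨(Equiv.sigmaFiberEquiv t).symm.trans
    ((Equiv.sigmaCongrRight e).trans (Equiv.sigmaFiberEquiv t')), ?_⟩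
  funext a
  simp only [Function.comp, Equiv.trans_apply]
  have := (e (t a) ⟨a, rfl⟩).2
  exact this.symm

theorem cnt_degree {n d : ℕ} (t : Fin d → Fin n) : (cnt t).degree = d := by
  unfold cnt
  rw [map_sum]
  simp

theorem cnt_surj {n d : ℕ} (β : Fin n →₀ ℕ) (h : β.degree = d) : ∃ t : Fin d → Fin n, cnt t = β := by
  induction d generalizing β with
  | zero =>
    refine ⟨Fin.elim0, ?_⟩
    rw [Finsupp.degree_eq_zero_iff] at h
    rw [h]; simp [cnt]
  | succ d ih =>
    have : β ≠ 0 := by rintro rfl; simp at h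
    obtain ⟨i, hi⟩ := Finsupp.ne_iff.1 this
    have hle : Finsupp.single i 1 ≤ β := by
      rw [Finsupp.single_le_iff]; exact Nat.one_le_iff_ne_zero.2 hi
    obtain ⟨γ, rfl⟩ := exists_add_of_le hle
    rw [map_add] at h
    simp only [Finsupp.degree_single] at h
    obtain ⟨t, ht⟩ := ih γ (by omega)
    refine ⟨Fin.cons i t, ?_⟩
    rw [← ht]
    simp [cnt, Fin.sum_univ_succ]

theorem cnt_append {n M k : ℕ} (t : Fin M → Fin n) (s : Fin k → Fin n) :
    cnt (Fin.append t s) = cnt t + cnt s := by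
  simp [cnt, Fin.sum_univ_add]

/-- standard basis vector -/
def ev {n : ℕ} (i : Fin n) : Euc n := EuclideanSpace.single i 1

/-- elementary tensor -/
def eStar {X : Type*} [NormedAddCommGroup X] [NormedSpace ℝ X] {n k : ℕ} (s : Fin k → Fin n) (v : X) :
    ContinuousMultilinearMap ℝ (fun _ : Fin k => Euc n) X :=
  (ContinuousMultilinearMap.mkPiRing ℝ (Fin k) v).compContinuousLinearMap
    (fun a => EuclideanSpace.proj (s a))

theorem eStar_apply {X : Type*} [NormedAddCommGroup X] [NormedSpace ℝ X] {n k : ℕ}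
    (s : Fin k → Fin n) (v : X) (z : Fin k → Euc n) : eStar s v z = (∏ a, z a (s a)) • v := by
  simp [eStar]

theorem euc_sum {n : ℕ} (z : Euc n) : z = ∑ i, z i • ev i := by
  ext j
  simp [ev, Pi.single_apply]

theorem cmm_expand {X : Type*} [NormedAddCommGroup X] [NormedSpace ℝ X] {n k : ℕ}
    (S : ContinuousMultilinearMap ℝ (fun _ : Fin k => Euc n) X) :
    S = ∑ s : Fin k → Fin n, eStar s (S (fun a => ev (s a))) := by
  ext z
  rw [ContinuousMultilinearMap.sum_apply]
  have : z = fun a => ∑ i, z a i • ev i := by funext a; exact euc_sum (z a)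
  conv_lhs => rw [this]
  rw [ContinuousMultilinearMap.map_sum]
  refine Finset.sum_congr rfl fun s _ => ?_
  rw [ContinuousMultilinearMap.map_smul_univ, eStar_apply]

/-- coefficients of the operator in bases -/
def acoef (A : OpCoeff n k V W) (i : Fin (Module.finrank ℝ W)) (s : Fin k → Fin n)
    (j : Fin (Module.finrank ℝ V)) : ℝ :=
  (Module.finBasis ℝ W).repr (A (eStar s (Module.finBasis ℝ V j))) i

theorem acoef_spec (A : OpCoeff n k V W) (S : ContinuousMultilinearMap ℝ (fun _ : Fin k => Euc n) V)
    (i : Fin (Module.finrank ℝ W)) :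
    (Module.finBasis ℝ W).repr (A S) i =
      ∑ s, ∑ j, (Module.finBasis ℝ V).repr (S (fun a => ev (s a))) j * acoef A i s j := by
  have key : ∀ s : Fin k → Fin n, eStar s (S (fun a => ev (s a))) =
      ∑ j, (Module.finBasis ℝ V).repr (S (fun a => ev (s a))) j • eStar s (Module.finBasis ℝ V j) := by
    intro s
    ext z
    rw [ContinuousMultilinearMap.sum_apply]
    simp only [ContinuousMultilinearMap.smul_apply, eStar_apply]
    conv_lhs => rw [← (Module.finBasis ℝ V).sum_repr (S (fun a => ev (s a)))]
    rw [Finset.smul_sum]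
    refine Finset.sum_congr rfl fun j _ => ?_
    rw [smul_comm]
  conv_lhs => rw [cmm_expand S]
  rw [map_sum, map_sum, Finsupp.finsetSum_apply]
  refine Finset.sum_congr rfl fun s _ => ?_
  rw [key, map_sum, map_sum, Finsupp.finsetSum_apply]
  refine Finset.sum_congr rfl fun j _ => ?_
  simp [acoef]

open MvPolynomial in
/-- polynomial symbol matrix -/
def amat (A : OpCoeff n k V W) : Matrix (Fin (Module.finrank ℝ W)) (Fin (Module.finrank ℝ V))
    (MvPolynomial (Fin n) ℂ) :=
  Matrix.of fun i j => ∑ s : Fin k → Fin n, monomial (cnt s) (acoef A i s j : ℂ)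

theorem eval_cnt (ξ : Fin n → ℂ) (s : Fin k → Fin n) (c : ℂ) :
    MvPolynomial.eval ξ (MvPolynomial.monomial (cnt s) c) = c * ∏ a, ξ (s a) := by
  rw [MvPolynomial.eval_monomial]
  congr 1
  unfold cnt
  rw [← Finsupp.prod_finsetSum_index (by simp) (by intros; rw [pow_add])]
  simp

theorem amat_inj (A : OpCoeff n k V W) (hA : IsCElliptic A) (ξ : Fin n → ℂ) (hξ : ξ ≠ 0)
    (v : Fin (Module.finrank ℝ V) → ℂ)
    (h : ((amat A).map (MvPolynomial.eval ξ)).mulVec v = 0) : v = 0 := by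
  set b := Module.finBasis ℝ V
  set η₁ : Euc n := WithLp.toLp 2 (fun i => (ξ i).re)
  set η₂ : Euc n := WithLp.toLp 2 (fun i => (ξ i).im)
  set v₁ : V := ∑ j, (v j).re • b j
  set v₂ : V := ∑ j, (v j).im • b j
  have hv₁ : ∀ j, b.repr v₁ j = (v j).re := fun j => by
    simp only [v₁]
    have := congrFun (b.equivFun.apply_symm_apply (fun j => (v j).re)) j
    rwa [Module.Basis.equivFun_symm_apply] at this
  have hv₂ : ∀ j, b.repr v₂ j = (v j).im := fun j => by
    simp only [v₂]
    have := congrFun (b.equivFun.apply_symm_apply (fun j => (v j).im)) j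
    rwa [Module.Basis.equivFun_symm_apply] at this
  have hker : ∀ s : Fin k → Fin n, cxKernel n k η₁ η₂ (fun a => ev (s a)) = ∏ a, ξ (s a) := by
    intro s
    have : ∀ i, ((η₁ i : ℝ) : ℂ) + Complex.I * ((η₂ i : ℝ) : ℂ) = ξ i := by
      intro i
      simp only [η₁, η₂]
      rw [mul_comm]; exact Complex.re_add_im (ξ i)
    simp [cxKernel, ev, EuclideanSpace.inner_single_right, this]
  have hη : (η₁, η₂) ≠ 0 := by
    intro h0
    apply hξ
    have h1 : η₁ = 0 := (Prod.mk.inj h0).1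
    have h2 : η₂ = 0 := (Prod.mk.inj h0).2
    funext i
    apply Complex.ext
    · exact congrArg (fun w : Euc n => w i) h1
    · exact congrArg (fun w : Euc n => w i) h2
  have hsum : ∀ i, ∑ s : Fin k → Fin n, ∑ j, ((∏ a, ξ (s a)) * v j) * (acoef A i s j : ℂ) = 0 := by
    intro i
    have := congrFun h i
    simp only [Matrix.mulVec, dotProduct, Matrix.map_apply, amat, Matrix.of_apply, map_sum,
      eval_cnt, Pi.zero_apply, Finset.sum_mul] at this
    rw [Finset.sum_comm] at this
    rw [← this]
    refine Finset.sum_congr rfl fun s _ => Finset.sum_congr rfl fun j _ => by ring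
  have h1 : A (cxSymTensorRe n k η₁ η₂ v₁ v₂) = 0 := by
    apply (Module.finBasis ℝ W).repr.injective
    ext i
    rw [acoef_spec]
    have := congrArg Complex.re (hsum i)
    simp only [Complex.re_sum, Complex.re_mul_ofReal] at this
    simp only [map_zero, Finsupp.coe_zero, Pi.zero_apply]
    rw [← Complex.zero_re, ← this]
    refine Finset.sum_congr rfl fun s _ => Finset.sum_congr rfl fun j _ => ?_
    congr 1
    simp [cxSymTensorRe, hker, Complex.mul_re, hv₁, hv₂, b]
  have h2 : A (cxSymTensorIm n k η₁ η₂ v₁ v₂) = 0 := by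
    apply (Module.finBasis ℝ W).repr.injective
    ext i
    rw [acoef_spec]
    have := congrArg Complex.im (hsum i)
    simp only [Complex.im_sum, Complex.im_mul_ofReal] at this
    simp only [map_zero, Finsupp.coe_zero, Pi.zero_apply]
    rw [← Complex.zero_im, ← this]
    refine Finset.sum_congr rfl fun s _ => Finset.sum_congr rfl fun j _ => ?_
    congr 1
    simp [cxSymTensorIm, hker, Complex.mul_im, hv₁, hv₂, b]
    ring
  obtain ⟨e1, e2⟩ := hA η₁ η₂ v₁ v₂ hη h1 h2
  funext j
  apply Complex.ext
  · rw [← hv₁, e1]; simp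
  · rw [← hv₂, e2]; simp

open MvPolynomial in
/-- ideal of multipliers -/
def aideal (A : OpCoeff n k V W) : Ideal (MvPolynomial (Fin n) ℂ) where
  carrier := {f | ∃ B : Matrix (Fin (Module.finrank ℝ V)) (Fin (Module.finrank ℝ W))
    (MvPolynomial (Fin n) ℂ), B * amat A = f • 1}
  zero_mem' := ⟨0, by simp⟩
  add_mem' := by
    rintro f g ⟨B, hB⟩ ⟨C, hC⟩
    exact ⟨B + C, by rw [Matrix.add_mul, hB, hC, add_smul]⟩
  smul_mem' := by
    rintro c f ⟨B, hB⟩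
    exact ⟨c • B, by rw [Matrix.smul_mul, hB, smul_smul]; rfl⟩

theorem aideal_pow (A : OpCoeff n k V W) (hA : IsCElliptic A) :
    ∃ r : ℕ, ∀ i, (MvPolynomial.X i : MvPolynomial (Fin n) ℂ) ^ r ∈ aideal A := by
  have hz : ∀ z ∈ MvPolynomial.zeroLocus ℂ (aideal A), z = 0 := by
    intro z hz
    by_contra hne
    have hinj := amat_inj A hA z hne
    set Mz := (amat A).map (MvPolynomial.eval z)
    obtain ⟨g, hg⟩ := LinearMap.exists_leftInverse_of_injective (Matrix.toLin' Mz)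
      (LinearMap.ker_eq_bot'.2 (fun v hv => hinj v (by simpa using hv)))
    set L := LinearMap.toMatrix' g
    have hL : L * Mz = 1 := by
      have := congrArg LinearMap.toMatrix' hg
      rw [LinearMap.toMatrix'_comp, LinearMap.toMatrix'_toLin', LinearMap.toMatrix'_id] at this
      exact this
    set LA := (L.map (MvPolynomial.C (σ := Fin n))) * amat A
    have hmem : LA.det ∈ aideal A := by
      refine ⟨LA.adjugate * (L.map (MvPolynomial.C (σ := Fin n))), ?_⟩
      rw [Matrix.mul_assoc]
      exact Matrix.adjugate_mul LA
    have h0 := hz _ hmem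
    rw [MvPolynomial.aeval_eq_eval] at h0
    have h1 : MvPolynomial.eval z LA.det = 1 := by
      have h3 : LA.map (MvPolynomial.eval z) = 1 := by
        simp only [LA]
        rw [Matrix.map_mul, Matrix.map_map]
        have : (L.map ((MvPolynomial.eval z) ∘ (MvPolynomial.C (σ := Fin n)))) = L := by
          ext i j; simp
        rw [this]; exact hL
      rw [RingHom.map_det]
      have : (MvPolynomial.eval z).mapMatrix LA = 1 := h3
      rw [this, Matrix.det_one]
    have h2 : MvPolynomial.eval z LA.det = 0 := h0
    rw [h1] at h2
    exact one_ne_zero h2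
  have hr : ∀ i, ∃ r, (MvPolynomial.X i : MvPolynomial (Fin n) ℂ) ^ r ∈ aideal A := by
    intro i
    have : (MvPolynomial.X i : MvPolynomial (Fin n) ℂ) ∈ (aideal A).radical := by
      rw [← MvPolynomial.vanishingIdeal_zeroLocus_eq_radical (K := ℂ)]
      intro z hzz
      rw [hz z hzz]
      simp
    exact this
  choose r hr using hr
  refine ⟨∑ i, r i, fun i => ?_⟩
  exact (aideal A).pow_mem_of_pow_mem (hr i)
    (Finset.single_le_sum (fun _ _ => Nat.zero_le _) (Finset.mem_univ i))

end Alg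

section Alg2
variable {n k : ℕ} {V W : Type*}
  [NormedAddCommGroup V] [InnerProductSpace ℝ V] [FiniteDimensional ℝ V]
  [NormedAddCommGroup W] [InnerProductSpace ℝ W] [FiniteDimensional ℝ W]

open Classical in
/-- coefficient function of a symmetric tensor -/
def hcoef {d : ℕ} (S : ContinuousMultilinearMap ℝ (fun _ : Fin d => Euc n) V)
    (j : Fin (Module.finrank ℝ V)) (α : Fin n →₀ ℕ) : ℂ :=
  if h : ∃ t : Fin d → Fin n, cnt t = α then
    (((Module.finBasis ℝ V).repr (S (fun a => ev (h.choose a))) j : ℝ) : ℂ) else 0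

theorem hcoef_cnt {d : ℕ} (S : ContinuousMultilinearMap ℝ (fun _ : Fin d => Euc n) V)
    (hS : ∀ (σ : Equiv.Perm (Fin d)) (z : Fin d → Euc n), S (z ∘ σ) = S z)
    (j : Fin (Module.finrank ℝ V)) (t : Fin d → Fin n) :
    hcoef S j (cnt t) = (((Module.finBasis ℝ V).repr (S (fun a => ev (t a))) j : ℝ) : ℂ) := by
  have h : ∃ t' : Fin d → Fin n, cnt t' = cnt t := ⟨t, rfl⟩
  unfold hcoef
  rw [dif_pos h]
  obtain ⟨σ, hσ⟩ := cnt_perm _ _ h.choose_spec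
  rw [hσ]
  have := hS σ (fun a => ev (t a))
  rw [← this]
  rfl

theorem hcoef_deg {d : ℕ} (S : ContinuousMultilinearMap ℝ (fun _ : Fin d => Euc n) V)
    (j : Fin (Module.finrank ℝ V)) (α : Fin n →₀ ℕ) (h : α.degree ≠ d) : hcoef S j α = 0 := by
  unfold hcoef
  rw [dif_neg]
  rintro ⟨t, rfl⟩
  exact h (cnt_degree t)

theorem pa_alg (hn : 0 < n) (A : OpCoeff n k V W) (hA : IsCElliptic A) :
    ∃ M : ℕ, ∀ S : ContinuousMultilinearMap ℝ (fun _ : Fin (M + k) => Euc n) V,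
      (∀ (σ : Equiv.Perm (Fin (M + k))) (z : Fin (M + k) → Euc n), S (z ∘ σ) = S z) →
      ∀ Sz : (Fin M → Euc n) → ContinuousMultilinearMap ℝ (fun _ : Fin k => Euc n) V,
      (∀ z v, Sz z v = S (Fin.append z v)) → (∀ z, A (Sz z) = 0) → S = 0 := by
  obtain ⟨r, hr⟩ := aideal_pow A hA
  obtain ⟨M, hM⟩ : ∃ M, M = n * r := ⟨_, rfl⟩
  refine ⟨M, fun S hS Sz hSz hSA => ?_⟩
  set H : Fin (Module.finrank ℝ V) → (MvPolynomial (Fin n) ℂ →ₗ[ℂ] ℂ) := fun j =>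
    (MvPolynomial.basisMonomials (Fin n) ℂ).constr ℂ (hcoef S j)
  have hH : ∀ j α c, H j (MvPolynomial.monomial α c) = c * hcoef S j α := by
    intro j α c
    have : MvPolynomial.monomial α c = c • (MvPolynomial.basisMonomials (Fin n) ℂ) α := by
      simp [MvPolynomial.smul_monomial]
    rw [this, map_smul]
    simp only [H, Module.Basis.constr_basis, smul_eq_mul]
  have claim1 : ∀ p i, ∑ j, H j (p * amat A i j) = 0 := by
    intro p i
    induction p using MvPolynomial.induction_on' with
    | add p q hp hq =>
      simp only [add_mul, map_add, Finset.sum_add_distrib, hp, hq, add_zero]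
    | monomial β c =>
      simp only [amat, Matrix.of_apply, Finset.mul_sum, MvPolynomial.monomial_mul, map_sum, hH]
      by_cases hβ : β.degree = M
      · obtain ⟨t, rfl⟩ := cnt_surj β hβ
        simp only [← cnt_append, hcoef_cnt S hS]
        have h1 := acoef_spec A (Sz (fun a => ev (t a))) i
        rw [hSA] at h1
        simp only [map_zero, Finsupp.coe_zero, Pi.zero_apply] at h1
        have h2 : ∀ s : Fin k → Fin n, (fun a => (ev (Fin.append t s a) : Euc n)) =
            Fin.append (fun a => ev (t a)) (fun a => ev (s a)) := by
          intro s
          funext a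
          refine Fin.addCases (fun a => ?_) (fun a => ?_) a <;> simp
        simp only [h2, ← hSz]
        rw [Finset.sum_comm]
        have h3 := congrArg (fun x : ℝ => c * (x : ℂ)) h1
        simp only [Complex.ofReal_zero, mul_zero, Complex.ofReal_sum, Finset.mul_sum] at h3
        rw [h3]
        refine Finset.sum_congr rfl fun s _ => Finset.sum_congr rfl fun j _ => ?_
        push_cast; ring
      · refine Finset.sum_eq_zero fun j _ => Finset.sum_eq_zero fun s _ => ?_
        rw [hcoef_deg, mul_zero]
        rw [map_add, cnt_degree]
        omega
  have claim2 : ∀ q i j, H j (q * MvPolynomial.X i ^ r) = 0 := by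
    intro q i j'
    obtain ⟨B, hB⟩ := hr i
    have h1 : ∀ j, ∑ i', B j' i' * amat A i' j = if j' = j then MvPolynomial.X i ^ r else 0 := by
      intro j
      have := congrFun (congrFun hB j') j
      rw [Matrix.mul_apply] at this
      rw [this]
      simp [Matrix.one_apply]
    have h2 : H j' (q * MvPolynomial.X i ^ r) =
        ∑ j, H j (q * if j' = j then MvPolynomial.X i ^ r else 0) := by
      rw [Finset.sum_eq_single j']
      · simp
      · intro b _ hb
        rw [if_neg (Ne.symm hb)]; simp
      · simp
    rw [h2]
    simp only [← h1, Finset.mul_sum, map_sum]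
    rw [Finset.sum_comm]
    refine Finset.sum_eq_zero fun i' _ => ?_
    simp only [← mul_assoc]
    exact claim1 _ _
  have hfin : ∀ t : Fin (M + k) → Fin n, S (fun a => ev (t a)) = 0 := by
    intro t
    have : ∃ i, r ≤ cnt t i := by
      by_contra hcon
      push Not at hcon
      have : Nonempty (Fin n) := ⟨⟨0, hn⟩⟩
      have h1 := Finset.sum_lt_sum_of_nonempty (s := (Finset.univ : Finset (Fin n)))
        Finset.univ_nonempty (fun i _ => hcon i)
      have h2 := cnt_degree t
      rw [Finsupp.degree_eq_sum] at h2
      simp at h1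
      omega
    obtain ⟨i, hi⟩ := this
    apply (Module.finBasis ℝ V).repr.injective
    ext j
    have h1 : MvPolynomial.monomial (cnt t) (1 : ℂ) =
        MvPolynomial.monomial (cnt t - Finsupp.single i r) 1 * MvPolynomial.X i ^ r := by
      rw [MvPolynomial.X_pow_eq_monomial, MvPolynomial.monomial_mul, mul_one,
        tsub_add_cancel_of_le (by rw [Finsupp.single_le_iff]; exact hi)]
    have h2 := claim2 (MvPolynomial.monomial (cnt t - Finsupp.single i r) 1) i j
    rw [← h1, hH, hcoef_cnt S hS, one_mul] at h2
    simpa using h2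
  rw [cmm_expand S]
  refine Finset.sum_eq_zero fun t _ => ?_
  rw [hfin]
  ext z
  simp [eStar_apply]

end Alg2

section Fac
variable {n k : ℕ} {V W : Type*}
  [NormedAddCommGroup V] [InnerProductSpace ℝ V] [FiniteDimensional ℝ V]
  [NormedAddCommGroup W] [InnerProductSpace ℝ W] [FiniteDimensional ℝ W]

instance cmm_fd {X : Type*} [NormedAddCommGroup X] [NormedSpace ℝ X] [FiniteDimensional ℝ X]
    (n j : ℕ) : FiniteDimensional ℝ (ContinuousMultilinearMap ℝ (fun _ : Fin j => Euc n) X) :=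
  Module.Finite.of_injective
    ({ toFun := fun S => S.toMultilinearMap
       map_add' := fun _ _ => rfl
       map_smul' := fun _ _ => rfl } :
      ContinuousMultilinearMap ℝ (fun _ : Fin j => Euc n) X →ₗ[ℝ]
        MultilinearMap ℝ (fun _ : Fin j => Euc n) X)
    ContinuousMultilinearMap.toMultilinearMap_injective

theorem lin_factor {U X Y : Type*} [AddCommGroup U] [Module ℝ U] [AddCommGroup X] [Module ℝ X]
    [AddCommGroup Y] [Module ℝ Y] (f : U →ₗ[ℝ] X) (g : U →ₗ[ℝ] Y)
    (h : ∀ q, f q = 0 → g q = 0) : ∃ B : X →ₗ[ℝ] Y, ∀ q, g q = B (f q) := by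
  obtain ⟨s, hs⟩ := LinearMap.exists_rightInverse_of_surjective f.rangeRestrict
    (LinearMap.range_rangeRestrict f)
  obtain ⟨B, hB⟩ := LinearMap.exists_extend (g ∘ₗ s)
  refine ⟨B, fun q => ?_⟩
  have h1 : B (f q) = g (s (f.rangeRestrict q)) := by
    have := LinearMap.congr_fun hB (f.rangeRestrict q)
    exact this
  rw [h1]
  have h2 : f (q - s (f.rangeRestrict q)) = 0 := by
    have := congrArg Subtype.val (LinearMap.congr_fun hs (f.rangeRestrict q))
    simp only [LinearMap.comp_apply, LinearMap.id_apply] at this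
    rw [map_sub, sub_eq_zero]
    exact this.symm
  have := h _ h2
  rwa [map_sub, sub_eq_zero] at this

/-- smooth functions as a submodule -/
def Sm (n : ℕ) (X : Type*) [NormedAddCommGroup X] [NormedSpace ℝ X] :
    Submodule ℝ (Euc n → X) where
  carrier := {f | ContDiff ℝ (⊤ : ℕ∞) f}
  zero_mem' := by
    change ContDiff ℝ (⊤ : ℕ∞) (fun _ => (0 : X))
    exact contDiff_const
  add_mem' := by
    intro f g hf hg
    change ContDiff ℝ (⊤ : ℕ∞) f at hf
    change ContDiff ℝ (⊤ : ℕ∞) g at hg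
    exact hf.add hg
  smul_mem' := by
    intro c f hf
    change ContDiff ℝ (⊤ : ℕ∞) f at hf
    exact hf.const_smul c

theorem smCd {n : ℕ} {X : Type*} [NormedAddCommGroup X] [NormedSpace ℝ X] (q : Sm n X) :
    ContDiff ℝ (⊤ : ℕ∞) q.1 := q.2

variable {X Y : Type*} [NormedAddCommGroup X] [NormedSpace ℝ X]
  [NormedAddCommGroup Y] [NormedSpace ℝ Y]

/-- iterated derivative as a linear map on smooth functions -/
def smD (n : ℕ) (X : Type*) [NormedAddCommGroup X] [NormedSpace ℝ X] (j : ℕ) :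
    Sm n X →ₗ[ℝ] Sm n (ContinuousMultilinearMap ℝ (fun _ : Fin j => Euc n) X) where
  toFun q := ⟨iteratedFDeriv ℝ j q.1, pa_smooth_iter (smCd q) j⟩
  map_add' := by
    intro p q
    apply Subtype.ext
    funext x
    have hp : ContDiff ℝ (j : WithTop ℕ∞) p.1 := ContDiff.of_le (smCd p) (by exact_mod_cast le_top)
    have hq : ContDiff ℝ (j : WithTop ℕ∞) q.1 := ContDiff.of_le (smCd q) (by exact_mod_cast le_top)
    exact iteratedFDeriv_add_apply hp.contDiffAt hq.contDiffAt
  map_smul' := by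
    intro c q
    apply Subtype.ext
    funext x
    have hq : ContDiff ℝ (j : WithTop ℕ∞) q.1 := ContDiff.of_le (smCd q) (by exact_mod_cast le_top)
    exact iteratedFDeriv_const_smul_apply hq.contDiffAt

/-- composition with a linear map -/
def smL (n : ℕ) (L : X →L[ℝ] Y) : Sm n X →ₗ[ℝ] Sm n Y where
  toFun q := ⟨fun x => L (q.1 x), L.contDiff.comp (smCd q)⟩
  map_add' := by
    intro p q
    apply Subtype.ext
    funext x
    exact L.map_add _ _
  map_smul' := by
    intro c q
    apply Subtype.ext
    funext x
    exact L.map_smul _ _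

/-- evaluation -/
def smE (x : Euc n) : Sm n X →ₗ[ℝ] X where
  toFun q := q.1 x
  map_add' := fun _ _ => rfl
  map_smul' := fun _ _ => rfl

/-- the operator as a linear map on smooth functions -/
def smA (A : OpCoeff n k V W) : Sm n V →ₗ[ℝ] Sm n W := smL n A ∘ₗ smD n V k

theorem smA_apply (A : OpCoeff n k V W) (q : Sm n V) : (smA A q).1 = opApply A q.1 := rfl

theorem opApply_smooth (A : OpCoeff n k V W) {q : Euc n → V} (hq : ContDiff ℝ (⊤ : ℕ∞) q) :
    ContDiff ℝ (⊤ : ℕ∞) (opApply A q) := smCd (smA A ⟨q, hq⟩)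

theorem pa_factor (hn : 0 < n) (A : OpCoeff n k V W) (hA : IsCElliptic A) :
    ∃ M : ℕ, ∀ m l : ℕ, m + l = M + k →
      ∃ B : (ContinuousMultilinearMap ℝ (fun _ : Fin M => Euc n) W) →L[ℝ]
        (ContinuousMultilinearMap ℝ (fun _ : Fin m => Euc n)
          (ContinuousMultilinearMap ℝ (fun _ : Fin l => Euc n) V)),
      ∀ q : Euc n → V, ContDiff ℝ (⊤ : ℕ∞) q → ∀ x,
        iteratedFDeriv ℝ m (iteratedFDeriv ℝ l q) x = B (iteratedFDeriv ℝ M (opApply A q) x) := by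
  obtain ⟨M, hM⟩ := pa_alg hn A hA
  refine ⟨M, fun m l hml => ?_⟩
  obtain ⟨B, hB⟩ := lin_factor (smE (0 : Euc n) ∘ₗ smD n W M ∘ₗ smA A)
    (smE (0 : Euc n) ∘ₗ smD n _ m ∘ₗ smD n V l) (by
      intro q hq
      change iteratedFDeriv ℝ M (A ∘ iteratedFDeriv ℝ k q.1) 0 = 0 at hq
      change iteratedFDeriv ℝ m (iteratedFDeriv ℝ l q.1) 0 = 0
      have hk : ContDiff ℝ (M : WithTop ℕ∞) (iteratedFDeriv ℝ k q.1) :=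
        ContDiff.of_le (pa_smooth_iter (smCd q) k) (by exact_mod_cast le_top)
      rw [ContinuousLinearMap.iteratedFDeriv_comp_left A hk.contDiffAt le_rfl] at hq
      have h0 := hM (iteratedFDeriv ℝ (M + k) q.1 0)
        (fun σ z => pa_symm (smCd q) (M + k) 0 z σ)
        (fun z => iteratedFDeriv ℝ M (iteratedFDeriv ℝ k q.1) 0 z)
        (fun z v => pa_append k 0 z v)
        (fun z => by
          have := congrArg (fun T => T z) hq
          exact this)
      have h1 : ∀ j, j = M + k → iteratedFDeriv ℝ j q.1 0 = 0 := by
        rintro _ rfl; exact h0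
      ext z v
      rw [pa_append, h1 _ hml]
      rfl)
  refine ⟨LinearMap.toContinuousLinearMap B, fun q hq x => ?_⟩
  have hq' : ContDiff ℝ (⊤ : ℕ∞) (fun z => q (z + x)) :=
    hq.comp (contDiff_id.add contDiff_const)
  have h2 := hB ⟨_, hq'⟩
  change iteratedFDeriv ℝ m (iteratedFDeriv ℝ l (fun z => q (z + x))) 0 =
    B (iteratedFDeriv ℝ M (fun y => A (iteratedFDeriv ℝ k (fun z => q (z + x)) y)) 0) at h2
  have e1 : ∀ j, iteratedFDeriv ℝ j (fun z => q (z + x)) = fun z => iteratedFDeriv ℝ j q (z + x) := by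
    intro j; funext z; rw [iteratedFDeriv_comp_add_right]
  rw [e1, e1, iteratedFDeriv_comp_add_right, zero_add] at h2
  have e2 : iteratedFDeriv ℝ M (fun y => A (iteratedFDeriv ℝ k q (y + x))) 0 =
      iteratedFDeriv ℝ M (opApply A q) x := by
    have := iteratedFDeriv_comp_add_right (f := opApply A q) M x (0 : Euc n) (𝕜 := ℝ)
    rw [zero_add] at this
    exact this
  rw [e2] at h2
  exact h2

end Fac

section Ibp
variable {n : ℕ} {U W X : Type*}
  [NormedAddCommGroup U] [NormedSpace ℝ U]
  [NormedAddCommGroup W] [NormedSpace ℝ W]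
  [NormedAddCommGroup X] [NormedSpace ℝ X]

/-- insertion of a coordinate form in front -/
def insL (n M : ℕ) (W : Type*) [NormedAddCommGroup W] [NormedSpace ℝ W] (i : Fin n) :
    ContinuousMultilinearMap ℝ (fun _ : Fin M => Euc n) W →L[ℝ]
    ContinuousMultilinearMap ℝ (fun _ : Fin (M + 1) => Euc n) W :=
  ((continuousMultilinearCurryLeftEquiv ℝ (fun _ : Fin (M + 1) => Euc n) W).symm :
    (Euc n →L[ℝ] ContinuousMultilinearMap ℝ (fun _ : Fin M => Euc n) W) →L[ℝ] _) ∘L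
  (ContinuousLinearMap.smulRightL ℝ (Euc n) _ (EuclideanSpace.proj i))

theorem insL_apply (M : ℕ) (i : Fin n) (T : ContinuousMultilinearMap ℝ (fun _ : Fin M => Euc n) W)
    (z : Fin (M + 1) → Euc n) : insL n M W i T z = (z 0 i) • T (Fin.tail z) := by
  rfl

theorem succ_expand (M : ℕ) (G : Euc n → W) (y : Euc n) :
    iteratedFDeriv ℝ (M + 1) G y =
      ∑ i, insL n M W i (fderiv ℝ (iteratedFDeriv ℝ M G) y (ev i)) := by
  ext z
  rw [iteratedFDeriv_succ_apply_left, ContinuousMultilinearMap.sum_apply]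
  simp only [insL_apply]
  conv_lhs => rw [euc_sum (z 0)]
  rw [map_sum, ContinuousMultilinearMap.sum_apply]
  simp

theorem ibp_one (Φ : Euc n → (U →L[ℝ] X)) (hΦ : ContDiff ℝ (⊤ : ℕ∞) Φ)
    (K : Set (Euc n)) (hK : IsCompact K) (h0 : ∀ y, y ∉ K → Φ y = 0)
    (H : Euc n → U) (hH : ContDiff ℝ (⊤ : ℕ∞) H) (v : Euc n) :
    Integrable (fun y => Φ y (fderiv ℝ H y v)) volume ∧
    Integrable (fun y => (fderiv ℝ Φ y v) (H y)) volume ∧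
    ∫ y, Φ y (fderiv ℝ H y v) = - ∫ y, (fderiv ℝ Φ y v) (H y) := by
  have hcs : HasCompactSupport Φ := HasCompactSupport.intro hK h0
  have hcΦ := hΦ.continuous
  have hcH := hH.continuous
  have hcf : Continuous (fun y => fderiv ℝ Φ y v) :=
    (pa_smooth_fderiv hΦ).continuous.clm_apply continuous_const
  have hch : Continuous (fun y => fderiv ℝ H y v) :=
    (pa_smooth_fderiv hH).continuous.clm_apply continuous_const
  have hcs' : HasCompactSupport (fun y => fderiv ℝ Φ y v) := hcs.fderiv_apply ℝ v
  have i1 : Integrable (fun y => Φ y (fderiv ℝ H y v)) volume := by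
    refine (hcΦ.clm_apply hch).integrable_of_hasCompactSupport (hcs.mono ?_)
    intro y hy hy'
    apply hy
    simp only [hy', ContinuousLinearMap.zero_apply]
  have i2 : Integrable (fun y => (fderiv ℝ Φ y v) (H y)) volume := by
    refine (hcf.clm_apply hcH).integrable_of_hasCompactSupport (hcs'.mono ?_)
    intro y hy hy'
    apply hy
    simp only [hy', ContinuousLinearMap.zero_apply]
  have i3 : Integrable (fun y => (Φ y) (H y)) volume := by
    refine (hcΦ.clm_apply hcH).integrable_of_hasCompactSupport (hcs.mono ?_)
    intro y hy hy'
    apply hy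
    simp only [hy', ContinuousLinearMap.zero_apply]
  refine ⟨i1, i2, ?_⟩
  exact integral_bilinear_fderiv_right_eq_neg_left_of_integrable (μ := volume)
    (B := ContinuousLinearMap.id ℝ (U →L[ℝ] X)) i2 i1 i3
    (fun x _ => pa_smooth_diff hΦ x) (fun x _ => pa_smooth_diff hH x)

theorem ibp (K : Set (Euc n)) (hK : IsCompact K) (M : ℕ) :
    ∀ (Ψ : Euc n × Euc n → (ContinuousMultilinearMap ℝ (fun _ : Fin M => Euc n) W →L[ℝ] X)),
    ContDiff ℝ (⊤ : ℕ∞) Ψ → (∀ x y, y ∉ K → Ψ (x, y) = 0) →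
    ∃ Ψ' : Euc n × Euc n → (W →L[ℝ] X), ContDiff ℝ (⊤ : ℕ∞) Ψ' ∧
      (∀ x y, y ∉ K → Ψ' (x, y) = 0) ∧
      ∀ x, ∀ G : Euc n → W, ContDiff ℝ (⊤ : ℕ∞) G →
        ∫ y, Ψ (x, y) (iteratedFDeriv ℝ M G y) = ∫ y, Ψ' (x, y) (G y) := by
  induction M with
  | zero =>
    intro Ψ hΨ h0
    set c : W →L[ℝ] ContinuousMultilinearMap ℝ (fun _ : Fin 0 => Euc n) W :=
      (continuousMultilinearCurryFin0 ℝ (Euc n) W).symm.toContinuousLinearEquiv.toContinuousLinearMap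
    refine ⟨fun p => (Ψ p) ∘L c, hΨ.clm_comp contDiff_const, fun x y hy => ?_, fun x G _ => ?_⟩
    · simp only [h0 x y hy, ContinuousLinearMap.zero_comp]
    · rfl
  | succ M ih =>
    intro Ψ hΨ h0
    set Φ : Fin n → Euc n × Euc n → (ContinuousMultilinearMap ℝ (fun _ : Fin M => Euc n) W →L[ℝ] X) :=
      fun i p => (Ψ p) ∘L (insL n M W i)
    have hΦ : ∀ i, ContDiff ℝ (⊤ : ℕ∞) (Φ i) := fun i => hΨ.clm_comp contDiff_const
    have hΦx : ∀ i x, ContDiff ℝ (⊤ : ℕ∞) (fun y => Φ i (x, y)) := fun i x =>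
      (hΦ i).comp (contDiff_const.prodMk contDiff_id)
    have hΦ0 : ∀ i x y, y ∉ K → Φ i (x, y) = 0 := fun i x y hy => by
      simp only [Φ, h0 x y hy, ContinuousLinearMap.zero_comp]
    have hder : ∀ i x y, fderiv ℝ (Φ i) (x, y) (0, ev i) = fderiv ℝ (fun y => Φ i (x, y)) y (ev i) := by
      intro i x y
      have h1 : HasFDerivAt (fun y : Euc n => (x, y)) (ContinuousLinearMap.inr ℝ (Euc n) (Euc n)) y :=
        hasFDerivAt_prodMk_right x y
      have h2 := ((hΦ i).differentiable (by simp) (x, y)).hasFDerivAt.comp y h1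
      have h3 : fderiv ℝ (fun y => Φ i (x, y)) y = _ := h2.fderiv
      rw [h3]
      rfl
    obtain ⟨Ψ', h1, h2, h3⟩ := ih (fun p => - ∑ i, fderiv ℝ (Φ i) p (0, ev i))
      (by
        refine ContDiff.neg (ContDiff.sum fun i _ => ?_)
        exact ((hΦ i).fderiv_right (m := (⊤ : ℕ∞)) (by exact_mod_cast le_top)).clm_apply contDiff_const)
      (by
        intro x y hy
        rw [neg_eq_zero]
        refine Finset.sum_eq_zero fun i _ => ?_
        rw [hder]
        have : (fun y => Φ i (x, y)) =ᶠ[nhds y] fun _ => 0 := by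
          filter_upwards [hK.isClosed.isOpen_compl.mem_nhds hy] with z hz
          exact hΦ0 i x z hz
        rw [this.fderiv_eq]
        simp)
    refine ⟨Ψ', h1, h2, fun x G hG => ?_⟩
    rw [← h3 x G hG]
    have key := fun i => ibp_one (fun y => Φ i (x, y)) (hΦx i x) K hK (hΦ0 i x)
      (iteratedFDeriv ℝ M G) (pa_smooth_iter hG M) (ev i)
    have e1 : ∀ y, Ψ (x, y) (iteratedFDeriv ℝ (M + 1) G y) =
        ∑ i, Φ i (x, y) (fderiv ℝ (iteratedFDeriv ℝ M G) y (ev i)) := by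
      intro y
      rw [succ_expand, map_sum]
      rfl
    simp only [e1]
    rw [integral_finsetSum _ (fun i _ => (key i).1)]
    have e2 : ∀ y, (- ∑ i, fderiv ℝ (Φ i) (x, y) (0, ev i)) (iteratedFDeriv ℝ M G y) =
        - ∑ i, (fderiv ℝ (fun y => Φ i (x, y)) y (ev i)) (iteratedFDeriv ℝ M G y) := by
      intro y
      simp only [hder]
      rw [ContinuousLinearMap.neg_apply, ContinuousLinearMap.sum_apply]
    simp only [e2]
    rw [integral_neg, integral_finsetSum _ (fun i _ => (key i).2.1), ← Finset.sum_neg_distrib]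
    exact Finset.sum_congr rfl fun i _ => (key i).2.2

theorem ibp_bound (K : Set (Euc n)) (hK : IsCompact K) (M : ℕ) (R : ℝ)
    (Ψ : Euc n × Euc n → (ContinuousMultilinearMap ℝ (fun _ : Fin M => Euc n) W →L[ℝ] X))
    (hΨ : ContDiff ℝ (⊤ : ℕ∞) Ψ) (h0 : ∀ x y, y ∉ K → Ψ (x, y) = 0) :
    ∃ C : ℝ, 0 ≤ C ∧ ∀ x, ‖x‖ ≤ R → ∀ G : Euc n → W, ContDiff ℝ (⊤ : ℕ∞) G →
      ‖∫ y, Ψ (x, y) (iteratedFDeriv ℝ M G y)‖ ≤ C * ∫ y in K, ‖G y‖ := by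
  obtain ⟨Ψ', h1, h2, h3⟩ := ibp K hK M Ψ hΨ h0
  have hcomp : IsCompact (closedBall (0 : Euc n) R ×ˢ K) := (isCompact_closedBall 0 R).prod hK
  obtain ⟨C, hC⟩ := hcomp.exists_bound_of_continuousOn h1.continuous.continuousOn
  refine ⟨max C 0, le_max_right _ _, fun x hx G hG => ?_⟩
  rw [h3 x G hG]
  have e : ∫ y, Ψ' (x, y) (G y) = ∫ y in K, Ψ' (x, y) (G y) := by
    rw [setIntegral_eq_integral_of_forall_compl_eq_zero]
    intro y hy
    rw [h2 x y hy]; rfl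
  rw [e, ← integral_const_mul]
  refine norm_integral_le_of_norm_le ?_ ?_
  · exact ((hG.continuous.norm).continuousOn.integrableOn_compact hK).const_mul _
  · refine (ae_restrict_iff' hK.measurableSet).2 (Filter.Eventually.of_forall fun y hy => ?_)
    refine (ContinuousLinearMap.le_opNorm _ _).trans ?_
    gcongr
    exact (hC (x, y) ⟨by simpa using hx, hy⟩).trans (le_max_left _ _)

end Ibp

section Avg
open scoped Nat
variable {n : ℕ} {X Y : Type*}
  [NormedAddCommGroup X] [NormedSpace ℝ X] [FiniteDimensional ℝ X]
  [NormedAddCommGroup Y] [NormedSpace ℝ Y] [FiniteDimensional ℝ Y]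

theorem taylor_full {f : Euc n → X} (hf : ContDiff ℝ (⊤ : ℕ∞) f) (m : ℕ) (y x : Euc n) :
    f x = tay (m + 1) f y x + (m ! : ℝ)⁻¹ • ∫ t in (0 : ℝ)..1, (1 - t) ^ m •
      iteratedFDeriv ℝ (m + 1) f (y + t • (x - y)) (fun _ => x - y) := by
  have h := map_add_eq_sum_add_integral_iteratedFDeriv (f := f) (x := y) (y := x - y) (n := m)
    (fun t _ => ContDiff.contDiffAt (hf.of_le (by exact_mod_cast le_top)))
  rw [add_sub_cancel] at h
  exact h

/-- jets at the origin -/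
abbrev Jet (n d : ℕ) (X : Type*) [NormedAddCommGroup X] [NormedSpace ℝ X] : Type _ :=
  (j : Fin d) → ContinuousMultilinearMap ℝ (fun _ : Fin (j : ℕ) => Euc n) X

/-- jet map -/
def smJ (n d : ℕ) (X : Type*) [NormedAddCommGroup X] [NormedSpace ℝ X] : Sm n X →ₗ[ℝ] Jet n d X :=
  LinearMap.pi (fun j => smE 0 ∘ₗ smD n X j)

theorem smJ_apply (d : ℕ) (q : Sm n X) (j : Fin d) : smJ n d X q j = iteratedFDeriv ℝ j q.1 0 := rfl

theorem smJ_inj (d : ℕ) (q : Sm n X) (h : smD n X d q = 0) (h' : smJ n d X q = 0) : q = 0 := by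
  have hd : ∀ x, iteratedFDeriv ℝ d q.1 x = 0 := fun x => congrFun (congrArg Subtype.val h) x
  have hj : ∀ j, j < d → iteratedFDeriv ℝ j q.1 0 = 0 := fun j hj => congrFun h' ⟨j, hj⟩
  apply Subtype.ext
  funext x
  change q.1 x = 0
  cases d with
  | zero =>
    have := congrArg (fun T => T 0) (hd x)
    simpa using this
  | succ m =>
    rw [taylor_full (smCd q) m 0 x]
    simp only [hd]
    have : tay (m + 1) q.1 0 x = 0 := by
      unfold tay
      refine Finset.sum_eq_zero fun j hjm => ?_
      rw [hj j (Finset.mem_range.1 hjm)]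
      simp
    rw [this]
    simp

theorem exists_Kv (n d : ℕ) (X : Type*) [NormedAddCommGroup X] [NormedSpace ℝ X]
    [FiniteDimensional ℝ X] : ∃ Kv : Jet n d X →ₗ[ℝ] Sm n X,
    (∀ c, smD n X d (Kv c) = 0) ∧ ∀ q, smD n X d q = 0 → Kv (smJ n d X q) = q := by
  set JJ : LinearMap.ker (smD n X d) →ₗ[ℝ] Jet n d X :=
    smJ n d X ∘ₗ (LinearMap.ker (smD n X d)).subtype with hJJ
  have hker : ∀ q, JJ q = 0 → (LinearMap.id : LinearMap.ker (smD n X d) →ₗ[ℝ] _) q = 0 :=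
    fun q hq => Subtype.ext (by exact smJ_inj d q.1 q.2 hq)
  obtain ⟨L, hL⟩ := lin_factor (U := LinearMap.ker (smD n X d)) JJ LinearMap.id hker
  refine ⟨(LinearMap.ker (smD n X d)).subtype ∘ₗ L, fun c => (L c).2, fun q hq => ?_⟩
  have := hL ⟨q, hq⟩
  exact (congrArg Subtype.val this).symm

/-- Taylor polynomial as a smooth function -/
def smT (d : ℕ) (u : Euc n → X) (y : Euc n) : Sm n X := ⟨tay d u y, tay_contDiff d u y⟩

theorem smT_iter (d j : ℕ) (hj : j ≤ d) {u : Euc n → X} (hu : ContDiff ℝ (⊤ : ℕ∞) u) (y x : Euc n) :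
    iteratedFDeriv ℝ j (smT d u y).1 x = tay (d - j) (iteratedFDeriv ℝ j u) y x := by
  have := tay_iter j (d - j) hu y x
  rw [Nat.sub_add_cancel hj] at this
  exact this

theorem smT_top (d : ℕ) {u : Euc n → X} (hu : ContDiff ℝ (⊤ : ℕ∞) u) (y : Euc n) :
    smD n X d (smT d u y) = 0 := by
  apply Subtype.ext
  funext x
  change iteratedFDeriv ℝ d (smT d u y).1 x = 0
  rw [smT_iter d d le_rfl hu]
  simp [tay]

/-- averaged jet -/
def avJ (w : Euc n → ℝ) (d : ℕ) (u : Euc n → X) : Jet n d X := ∫ y, w y • smJ n d X (smT d u y)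

theorem avJ_int (w : Euc n → ℝ) (hw : Continuous w) (hws : HasCompactSupport w) (d : ℕ)
    {u : Euc n → X} (hu : ContDiff ℝ (⊤ : ℕ∞) u) :
    Integrable (fun y => w y • smJ n d X (smT d u y)) volume := by
  refine Continuous.integrable_of_hasCompactSupport (hw.smul (continuous_pi fun j => ?_)) hws.smul_right
  have : ∀ y, smJ n d X (smT d u y) j = tay (d - j) (iteratedFDeriv ℝ j u) y 0 := fun y => by
    rw [smJ_apply, smT_iter d j j.2.le hu]
  simp only [this]
  exact tay_continuous _ (pa_smooth_iter hu j) 0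

theorem avJ_apply (w : Euc n → ℝ) (hw : Continuous w) (hws : HasCompactSupport w) (d : ℕ)
    (Kv : Jet n d X →ₗ[ℝ] Sm n X) (hKv : ∀ q, smD n X d q = 0 → Kv (smJ n d X q) = q)
    {u : Euc n → X} (hu : ContDiff ℝ (⊤ : ℕ∞) u) (fl : Sm n X →ₗ[ℝ] Y) :
    fl (Kv (avJ w d u)) = ∫ y, w y • fl (smT d u y) := by
  have h := (LinearMap.toContinuousLinearMap (fl ∘ₗ Kv)).integral_comp_comm (avJ_int w hw hws d hu)
  have h2 : ∀ y, (LinearMap.toContinuousLinearMap (fl ∘ₗ Kv)) (w y • smJ n d X (smT d u y)) =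
      w y • fl (smT d u y) := by
    intro y
    rw [map_smul]
    change w y • fl (Kv _) = _
    rw [hKv _ (smT_top d hu y)]
  simp only [h2] at h
  exact h.symm

theorem avJ_congr (w : Euc n → ℝ) (K : Set (Euc n)) (hw : ∀ y, y ∉ K → w y = 0) (d : ℕ)
    {u v : Euc n → X} (h : ∀ y ∈ K, u =ᶠ[nhds y] v) : avJ w d u = avJ w d v := by
  unfold avJ
  congr 1
  funext y
  by_cases hy : y ∈ K
  · have : smT d u y = smT d v y := by
      apply Subtype.ext
      funext x
      exact tay_congr d (h y hy) x
    rw [this]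
  · rw [hw y hy, zero_smul, zero_smul]

theorem lin_sup_bound {C : Type*} [NormedAddCommGroup C] [NormedSpace ℝ C] [FiniteDimensional ℝ C]
    (L : C →ₗ[ℝ] Sm n Y) (R : ℝ) :
    ∃ c : ℝ, 0 ≤ c ∧ ∀ e x, ‖x‖ ≤ R → ‖(L e).1 x‖ ≤ c * ‖e‖ := by
  set b := Module.finBasis ℝ C
  have h1 : ∀ i, ∃ c, ∀ x ∈ closedBall (0 : Euc n) R, ‖(L (b i)).1 x‖ ≤ c := fun i =>
    (isCompact_closedBall 0 R).exists_bound_of_continuousOn (smCd (L (b i))).continuous.continuousOn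
  choose c hc using h1
  have h2 : ∀ i, ∃ a : ℝ, 0 ≤ a ∧ ∀ e, ‖b.repr e i‖ ≤ a * ‖e‖ := fun i =>
    ⟨‖LinearMap.toContinuousLinearMap (b.coord i)‖, norm_nonneg _, fun e =>
      (LinearMap.toContinuousLinearMap (b.coord i)).le_opNorm e⟩
  choose a ha0 ha using h2
  refine ⟨∑ i, a i * max (c i) 0, Finset.sum_nonneg fun i _ =>
    mul_nonneg (ha0 i) (le_max_right _ _), fun e x hx => ?_⟩
  have h3 : (L e).1 x = ∑ i, b.repr e i • (L (b i)).1 x := by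
    have : smE x (L e) = ∑ i, b.repr e i • smE x (L (b i)) := by
      conv_lhs => rw [← b.sum_repr e]
      simp only [map_sum, map_smul]
    exact this
  rw [h3, Finset.sum_mul]
  refine (norm_sum_le _ _).trans (Finset.sum_le_sum fun i _ => ?_)
  rw [norm_smul]
  calc ‖b.repr e i‖ * ‖(L (b i)).1 x‖ ≤ (a i * ‖e‖) * max (c i) 0 := by
        gcongr
        · exact mul_nonneg (ha0 i) (norm_nonneg _)
        · exact ha i e
        · exact (hc i x (by simpa using hx)).trans (le_max_left _ _)
    _ = a i * max (c i) 0 * ‖e‖ := by ring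

/-- evaluation on the diagonal -/
def evD (j : ℕ) (a : Euc n) : ContinuousMultilinearMap ℝ (fun _ : Fin j => Euc n) X →L[ℝ] X :=
  ContinuousMultilinearMap.apply ℝ (fun _ : Fin j => Euc n) X (fun _ => a)

theorem evD_smooth (j : ℕ) : ContDiff ℝ (⊤ : ℕ∞) (evD (n := n) (X := X) j) := by
  rw [contDiff_clm_apply_iff]
  intro S
  exact S.contDiff.comp (contDiff_pi.2 fun _ => contDiff_id)

theorem avg_bound (w : Euc n → ℝ) (hw : ContDiff ℝ (⊤ : ℕ∞) w) (K : Set (Euc n)) (hK : IsCompact K)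
    (hwK : ∀ y, y ∉ K → w y = 0) (m i : ℕ) :
    ∃ C : ℝ, 0 ≤ C ∧ ∀ g : Euc n → X, ContDiff ℝ (⊤ : ℕ∞) g →
      ‖∫ y, w y • tay m (iteratedFDeriv ℝ i g) y 0‖ ≤ C * ∫ y in K, ‖g y‖ := by
  have h1 : ∀ j : ℕ, ∃ C : ℝ, 0 ≤ C ∧ ∀ g : Euc n → X, ContDiff ℝ (⊤ : ℕ∞) g →
      ‖∫ y, w y • ((j ! : ℝ)⁻¹ • iteratedFDeriv ℝ j (iteratedFDeriv ℝ i g) y (fun _ => 0 - y))‖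
        ≤ C * ∫ y in K, ‖g y‖ := by
    intro j
    have hev2 : ContDiff ℝ (⊤ : ℕ∞) (fun p : Euc n × Euc n => (w p.2) • ((j ! : ℝ)⁻¹ •
        evD (n := n) (X := ContinuousMultilinearMap ℝ (fun _ : Fin i => Euc n) X) j (0 - p.2))) := by
      rw [contDiff_clm_apply_iff]
      intro S
      have h1 : ContDiff ℝ (⊤ : ℕ∞) (fun p : Euc n × Euc n => S (fun _ => 0 - p.2)) :=
        S.contDiff.comp (contDiff_pi.2 fun _ => contDiff_const.sub contDiff_snd)
      exact (hw.comp contDiff_snd).smul (h1.const_smul ((j ! : ℝ)⁻¹))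
    obtain ⟨Ψ', a1, a2, a3⟩ := ibp K hK j (W := ContinuousMultilinearMap ℝ (fun _ : Fin i => Euc n) X)
      (X := ContinuousMultilinearMap ℝ (fun _ : Fin i => Euc n) X)
      (fun p : Euc n × Euc n => (w p.2) • ((j ! : ℝ)⁻¹ • evD j (0 - p.2)))
      hev2
      (fun x y hy => by simp only [hwK y hy, zero_smul])
    obtain ⟨C, hC0, hC⟩ := ibp_bound K hK i 0 Ψ' a1 a2
    refine ⟨C, hC0, fun g hg => ?_⟩
    have h := hC 0 (by simp) g hg
    rw [← a3 0 _ (pa_smooth_iter hg i)] at h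
    exact h
  choose C hC0 hC using h1
  refine ⟨∑ j ∈ Finset.range m, C j, Finset.sum_nonneg fun j _ => hC0 j, fun g hg => ?_⟩
  have e : ∀ y, w y • tay m (iteratedFDeriv ℝ i g) y 0 = ∑ j ∈ Finset.range m,
      w y • ((j ! : ℝ)⁻¹ • iteratedFDeriv ℝ j (iteratedFDeriv ℝ i g) y (fun _ => 0 - y)) := by
    intro y
    unfold tay
    rw [Finset.smul_sum]
  simp only [e]
  rw [integral_finsetSum]
  · rw [Finset.sum_mul]
    exact (norm_sum_le _ _).trans (Finset.sum_le_sum fun j _ => hC j g hg)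
  · intro j _
    have hcs : HasCompactSupport w := HasCompactSupport.intro hK hwK
    have hc : Continuous (fun y => iteratedFDeriv ℝ j (iteratedFDeriv ℝ i g) y (fun _ => 0 - y)) :=
      (pa_smooth_iter (pa_smooth_iter hg i) j).continuous.eval
        (continuous_pi fun _ => continuous_const.sub continuous_id)
    exact Continuous.integrable_of_hasCompactSupport (hw.continuous.smul
      (hc.const_smul (j ! : ℝ)⁻¹)) hcs.smul_right

end Avg

section Rem
open scoped Nat
variable {n : ℕ} {W Y : Type*}
  [NormedAddCommGroup W] [NormedSpace ℝ W] [FiniteDimensional ℝ W]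
  [NormedAddCommGroup Y] [NormedSpace ℝ Y] [FiniteDimensional ℝ Y]

theorem iter_affine (M : ℕ) {g : Euc n → W} (hg : ContDiff ℝ (⊤ : ℕ∞) g) (a : ℝ) (b y : Euc n) :
    iteratedFDeriv ℝ M (fun y => g (a • y + b)) y = a ^ M • iteratedFDeriv ℝ M g (a • y + b) := by
  have h1 : ContDiff ℝ (M : WithTop ℕ∞) (fun z => g (z + b)) :=
    ContDiff.of_le (hg.comp (contDiff_id.add contDiff_const)) (by exact_mod_cast le_top)
  have h2 := iteratedFDeriv_comp_const_smul (f := fun z => g (z + b)) a h1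
  have h3 := congrFun h2 y
  simp only [iteratedFDeriv_comp_add_right] at h3
  exact h3

theorem rem_bound (w : Euc n → ℝ) (hw : ContDiff ℝ (⊤ : ℕ∞) w) (K : Set (Euc n)) (hK : IsCompact K)
    (hwK : ∀ y, y ∉ K → w y = 0) (hw1 : ∫ y, w y = 1) (M e : ℕ)
    (B : ContinuousMultilinearMap ℝ (fun _ : Fin M => Euc n) W →L[ℝ]
      ContinuousMultilinearMap ℝ (fun _ : Fin (M + e + 1) => Euc n) Y) (R : ℝ) :
    ∃ C : ℝ, 0 ≤ C ∧ ∀ f : Euc n → Y, ContDiff ℝ (⊤ : ℕ∞) f → ∀ g : Euc n → W,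
      ContDiff ℝ (⊤ : ℕ∞) g →
      (∀ x, iteratedFDeriv ℝ (M + e + 1) f x = B (iteratedFDeriv ℝ M g x)) → ∀ x, ‖x‖ ≤ R →
      ‖f x - ∫ y, w y • tay (M + e + 1) f y x‖ ≤
        C * ∫ t in Set.Ioc (0 : ℝ) 1, ∫ y in K, ‖g ((1 - t) • y + t • x)‖ := by
  set Ψ : Euc n × Euc n → (ContinuousMultilinearMap ℝ (fun _ : Fin M => Euc n) W →L[ℝ] Y) :=
    fun p => w p.2 • (evD (M + e + 1) (p.1 - p.2) ∘L B) with hΨdef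
  have hΨ : ContDiff ℝ (⊤ : ℕ∞) Ψ := by
    rw [contDiff_clm_apply_iff]
    intro S
    have h1 : ContDiff ℝ (⊤ : ℕ∞) (fun p : Euc n × Euc n => (B S) (fun _ => p.1 - p.2)) :=
      (B S).contDiff.comp (contDiff_pi.2 fun _ => contDiff_fst.sub contDiff_snd)
    exact (hw.comp contDiff_snd).smul h1
  have hΨ0 : ∀ x y, y ∉ K → Ψ (x, y) = 0 := fun x y hy => by
    simp only [hΨdef, hwK y hy, zero_smul]
  obtain ⟨C, hC0, hC⟩ := ibp_bound K hK M R Ψ hΨ hΨ0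
  refine ⟨((M + e)! : ℝ)⁻¹ * C, by positivity, fun f hf g hg hfg x hx => ?_⟩
  have hcs : HasCompactSupport w := HasCompactSupport.intro hK hwK
  set h : Euc n → ℝ → Y := fun y t => (1 - t) ^ (M + e) • Ψ (x, y) (iteratedFDeriv ℝ M g (y + t • (x - y)))
    with hh
  have hhc : Continuous (Function.uncurry h) := by
    have c1 : Continuous (fun p : Euc n × ℝ => Ψ (x, p.1)) :=
      hΨ.continuous.comp (continuous_const.prodMk continuous_fst)
    have c2 : Continuous (fun p : Euc n × ℝ => iteratedFDeriv ℝ M g (p.1 + p.2 • (x - p.1))) :=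
      (pa_smooth_iter hg M).continuous.comp (by fun_prop)
    have c3 : Continuous (fun p : Euc n × ℝ => (1 - p.2) ^ (M + e)) := by fun_prop
    exact c3.smul (c1.clm_apply c2)
  have hh0 : ∀ y, y ∉ K → ∀ t, h y t = 0 := fun y hy t => by
    simp only [hh, hΨ0 x y hy, ContinuousLinearMap.zero_apply, smul_zero]
  have s1 : f x - ∫ y, w y • tay (M + e + 1) f y x =
      ((M + e)! : ℝ)⁻¹ • ∫ y, ∫ t in Set.Ioc (0 : ℝ) 1, h y t := by
    have e1 : f x = ∫ y, w y • f x := by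
      rw [integral_smul_const, hw1, one_smul]
    have i1 : Integrable (fun y => w y • f x) volume :=
      Continuous.integrable_of_hasCompactSupport (hw.continuous.smul continuous_const) hcs.smul_right
    have i2 : Integrable (fun y => w y • tay (M + e + 1) f y x) volume :=
      Continuous.integrable_of_hasCompactSupport (hw.continuous.smul (tay_continuous _ hf x))
        hcs.smul_right
    conv_lhs => rw [e1]
    rw [← integral_sub i1 i2, ← integral_smul]
    congr 1
    funext y
    rw [← smul_sub]
    conv_lhs => rw [taylor_full hf (M + e) y x, add_sub_cancel_left]
    rw [smul_comm, intervalIntegral.integral_of_le zero_le_one, ← integral_smul]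
    congr 2
    funext t
    rw [smul_comm, hfg]
    rfl
  have s2 : ∫ y, ∫ t in Set.Ioc (0 : ℝ) 1, h y t = ∫ t in Set.Ioc (0 : ℝ) 1, ∫ y, h y t := by
    have e1 : ∫ y, ∫ t in Set.Ioc (0 : ℝ) 1, h y t = ∫ y in K, ∫ t in Set.Ioc (0 : ℝ) 1, h y t := by
      rw [setIntegral_eq_integral_of_forall_compl_eq_zero]
      intro y hy
      simp only [hh0 y hy, integral_zero]
    have e2 : ∀ t, ∫ y, h y t = ∫ y in K, h y t := by
      intro t
      rw [setIntegral_eq_integral_of_forall_compl_eq_zero]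
      intro y hy
      exact hh0 y hy t
    simp only [e2]
    rw [e1]
    refine integral_integral_swap ?_
    rw [Measure.prod_restrict]
    have : IntegrableOn (Function.uncurry h) (K ×ˢ Set.Icc (0 : ℝ) 1) (volume.prod volume) :=
      hhc.continuousOn.integrableOn_compact (hK.prod isCompact_Icc)
    exact this.mono_set (Set.prod_mono le_rfl Set.Ioc_subset_Icc_self)
  have s3 : ∀ t, ∫ y, h y t = (1 - t) ^ e •
      ∫ y, Ψ (x, y) (iteratedFDeriv ℝ M (fun y => g ((1 - t) • y + t • x)) y) := by
    intro t
    rw [← integral_smul]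
    congr 1
    funext y
    rw [iter_affine M hg, map_smul, smul_smul, ← pow_add, add_comm e M]
    have : (1 - t) • y + t • x = y + t • (x - y) := by
      rw [sub_smul, one_smul, smul_sub]; abel
    rw [this]
  rw [s1, s2, norm_smul, mul_assoc, Real.norm_of_nonneg (by positivity)]
  gcongr
  rw [← integral_const_mul]
  have hcont : Continuous (fun t : ℝ => ∫ y in K, ‖g ((1 - t) • y + t • x)‖) := by
    refine continuous_parametric_integral_of_continuous (f := fun t y => ‖g ((1 - t) • y + t • x)‖) ?_ hK
    exact (hg.continuous.comp (by fun_prop)).norm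
  refine norm_integral_le_of_norm_le ?_ ?_
  · exact ((hcont.continuousOn.integrableOn_compact isCompact_Icc).mono_set
      Set.Ioc_subset_Icc_self).const_mul _
  · refine (ae_restrict_iff' measurableSet_Ioc).2 (Filter.Eventually.of_forall fun t ht => ?_)
    rw [s3, norm_smul, Real.norm_of_nonneg (pow_nonneg (by linarith [ht.2]) _)]
    have h1 := hC x hx (fun y => g ((1 - t) • y + t • x))
      (hg.comp (by fun_prop))
    have h2 : (1 - t) ^ e ≤ 1 := pow_le_one₀ (by linarith [ht.2]) (by linarith [ht.1])
    calc _ ≤ 1 * ‖∫ y, Ψ (x, y) (iteratedFDeriv ℝ M (fun y => g ((1 - t) • y + t • x)) y)‖ := by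
          gcongr
      _ ≤ _ := by rw [one_mul]; exact h1

end Rem

section Glob
variable {n k : ℕ} {V W : Type*}
  [NormedAddCommGroup V] [InnerProductSpace ℝ V] [FiniteDimensional ℝ V]
  [NormedAddCommGroup W] [InnerProductSpace ℝ W] [FiniteDimensional ℝ W]

theorem gen_inv {X Y : Type*} [AddCommGroup X] [Module ℝ X]
    [AddCommGroup Y] [Module ℝ Y] (f : X →ₗ[ℝ] Y) :
    ∃ s : Y →ₗ[ℝ] X, ∀ c, f (s (f c)) = f c := by
  obtain ⟨s, hs⟩ := LinearMap.exists_rightInverse_of_surjective f.rangeRestrict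
    (LinearMap.range_rangeRestrict f)
  obtain ⟨B, hB⟩ := LinearMap.exists_extend s
  refine ⟨B, fun c => ?_⟩
  have h1 : B (f c) = s (f.rangeRestrict c) := LinearMap.congr_fun hB (f.rangeRestrict c)
  rw [h1]
  exact congrArg Subtype.val (LinearMap.congr_fun hs (f.rangeRestrict c))

theorem smA_top (A : OpCoeff n k V W) (M : ℕ) (q : Sm n V) (hq : smD n V (M + k) q = 0) :
    smD n W M (smA A q) = 0 := by
  have hd : ∀ x, iteratedFDeriv ℝ (M + k) q.1 x = 0 := fun x => congrFun (congrArg Subtype.val hq) x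
  apply Subtype.ext
  funext x
  change iteratedFDeriv ℝ M (A ∘ iteratedFDeriv ℝ k q.1) x = 0
  have hk : ContDiff ℝ (M : WithTop ℕ∞) (iteratedFDeriv ℝ k q.1) :=
    ContDiff.of_le (pa_smooth_iter (smCd q) k) (by exact_mod_cast le_top)
  rw [ContinuousLinearMap.iteratedFDeriv_comp_left A hk.contDiffAt le_rfl]
  have : iteratedFDeriv ℝ M (iteratedFDeriv ℝ k q.1) x = 0 := by
    ext z v
    rw [pa_append, hd]
    rfl
  rw [this]
  ext z
  simp

theorem smA_smT (A : OpCoeff n k V W) (M : ℕ) {u : Euc n → V} (hu : ContDiff ℝ (⊤ : ℕ∞) u)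
    (y : Euc n) : smA A (smT (M + k) u y) = smT M (opApply A u) y := by
  apply Subtype.ext
  funext x
  change A (iteratedFDeriv ℝ k (smT (M + k) u y).1 x) = tay M (A ∘ iteratedFDeriv ℝ k u) y x
  rw [tay_clm M (pa_smooth_iter hu k), smT_iter _ _ (Nat.le_add_left _ _) hu, Nat.add_sub_cancel]

theorem glob (hn : 0 < n) (A : OpCoeff n k V W) (hA : IsCElliptic A) (l : ℕ) (hl : l < k)
    (w : Euc n → ℝ) (hw : ContDiff ℝ (⊤ : ℕ∞) w) (K : Set (Euc n)) (hK : IsCompact K)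
    (hwK : ∀ y, y ∉ K → w y = 0) (hw1 : ∫ y, w y = 1) (R : ℝ) :
    ∃ C : ℝ, 0 ≤ C ∧ ∃ Pm : (Euc n → V) → (Euc n → V),
      (∀ u, ContDiff ℝ (⊤ : ℕ∞) (Pm u)) ∧ (∀ u x, opApply A (Pm u) x = 0) ∧
      (∀ u v, (∀ y ∈ K, u =ᶠ[nhds y] v) → Pm u = Pm v) ∧
      ∀ u, ContDiff ℝ (⊤ : ℕ∞) u → ∀ x, ‖x‖ ≤ R →
        ‖iteratedFDeriv ℝ l u x - iteratedFDeriv ℝ l (Pm u) x‖ ≤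
          C * (∫ t in Set.Ioc (0 : ℝ) 1, ∫ y in K, ‖opApply A u ((1 - t) • y + t • x)‖)
            + C * ∫ y in K, ‖opApply A u y‖ := by
  obtain ⟨M, hM⟩ := pa_factor hn A hA
  obtain ⟨e, hk⟩ : ∃ e, k = l + (e + 1) := ⟨k - l - 1, by omega⟩
  obtain ⟨B, hB⟩ := hM (M + e + 1) l (by omega)
  obtain ⟨Kv, hKv1, hKv2⟩ := exists_Kv n (M + k) V
  set Θ : Jet n (M + k) V →ₗ[ℝ] Jet n M W := smJ n M W ∘ₗ smA A ∘ₗ Kv with hΘ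
  obtain ⟨s, hs⟩ := gen_inv Θ
  have hcs : HasCompactSupport w := HasCompactSupport.intro hK hwK
  obtain ⟨C1, hC10, hC1⟩ := rem_bound w hw K hK hwK hw1 M e B R
  obtain ⟨C2, hC20, hC2⟩ := lin_sup_bound (smD n V l ∘ₗ Kv ∘ₗ s) R
  have h3 := fun i : ℕ => avg_bound (X := W) w hw K hK hwK (M - i) i
  choose C3 hC30 hC3 using h3
  set C4 := ∑ i : Fin M, C3 i with hC4
  have hC40 : 0 ≤ C4 := Finset.sum_nonneg fun i _ => hC30 i
  set c : (Euc n → V) → Jet n (M + k) V := fun u => avJ w (M + k) u with hc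
  refine ⟨C1 + C2 * C4, by positivity, fun u => (Kv (c u - s (Θ (c u)))).1,
    fun u => smCd _, fun u x => ?_, fun u v huv => ?_, fun u hu x hx => ?_⟩
  · have h1 : smJ n M W (smA A (Kv (c u - s (Θ (c u))))) = 0 := by
      change Θ (c u - s (Θ (c u))) = 0
      rw [map_sub, hs, sub_self]
    have h2 := smJ_inj M _ (smA_top A M _ (hKv1 (c u - s (Θ (c u))))) h1
    exact congrFun (congrArg Subtype.val h2) x
  · have : c u = c v := avJ_congr w K hwK _ huv
    simp only [this]
  · have hg := opApply_smooth A hu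
    set g := opApply A u with hgdef
    have e1 : iteratedFDeriv ℝ l (Kv (c u - s (Θ (c u)))).1 x =
        iteratedFDeriv ℝ l (Kv (c u)).1 x - ((smD n V l ∘ₗ Kv ∘ₗ s) (Θ (c u))).1 x := by
      have : (smE x ∘ₗ smD n V l ∘ₗ Kv) (c u - s (Θ (c u))) =
        (smE x ∘ₗ smD n V l ∘ₗ Kv) (c u) - (smE x ∘ₗ smD n V l ∘ₗ Kv) (s (Θ (c u))) := map_sub _ _ _
      exact this
    have e2 : iteratedFDeriv ℝ l (Kv (c u)).1 x =
        ∫ y, w y • tay (M + e + 1) (iteratedFDeriv ℝ l u) y x := by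
      have := avJ_apply w hw.continuous hcs (M + k) Kv hKv2 hu (smE x ∘ₗ smD n V l)
      refine Eq.trans this ?_
      congr 1
      funext y
      congr 1
      have h5 := smT_iter (M + k) l (by omega) hu y x
      have h6 : M + k - l = M + e + 1 := by omega
      rw [h6] at h5
      exact h5
    have e3 : ‖Θ (c u)‖ ≤ C4 * ∫ y in K, ‖g y‖ := by
      have hpos : 0 ≤ ∫ y in K, ‖g y‖ := integral_nonneg fun _ => norm_nonneg _
      rw [pi_norm_le_iff_of_nonneg (by positivity)]
      intro i
      have := avJ_apply w hw.continuous hcs (M + k) Kv hKv2 hu (smE 0 ∘ₗ smD n W i ∘ₗ smA A)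
      have h6 : Θ (c u) i = ∫ y, w y • tay (M - i) (iteratedFDeriv ℝ i g) y 0 := by
        refine Eq.trans this ?_
        congr 1
        funext y
        congr 1
        simp only [LinearMap.comp_apply, smA_smT A M hu y]
        exact smT_iter M i i.2.le hg y 0
      rw [h6]
      refine (hC3 i g hg).trans ?_
      gcongr
      exact Finset.single_le_sum (f := fun i : Fin M => C3 i) (fun i _ => hC30 i) (Finset.mem_univ i)
    have e4 := hC1 (iteratedFDeriv ℝ l u) (pa_smooth_iter hu l) g hg (fun x => hB u hu x) x hx
    have e5 := hC2 (Θ (c u)) x hx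
    have hI1 : 0 ≤ ∫ t in Set.Ioc (0 : ℝ) 1, ∫ y in K, ‖g ((1 - t) • y + t • x)‖ :=
      integral_nonneg fun t => integral_nonneg fun y => norm_nonneg _
    have hI2 : 0 ≤ ∫ y in K, ‖g y‖ := integral_nonneg fun y => norm_nonneg _
    rw [e1, e2, ← sub_add]
    refine (norm_add_le _ _).trans ?_
    have e6 : ‖((smD n V l ∘ₗ Kv ∘ₗ s) (Θ (c u))).1 x‖ ≤ C2 * C4 * ∫ y in K, ‖g y‖ := by
      refine e5.trans ?_
      rw [mul_assoc]
      gcongr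
    refine add_le_add (e4.trans ?_) (e6.trans ?_)
    · exact mul_le_mul_of_nonneg_right (by linarith [mul_nonneg hC20 hC40]) hI1
    · exact mul_le_mul_of_nonneg_right (by linarith) hI2

end Glob

section Lp
variable {n : ℕ}

theorem lint_aff (f : Euc n → ℝ≥0∞) (hf : Measurable f) {a : ℝ} (ha : 1 / 2 ≤ a) (b : Euc n) :
    ∫⁻ y, f (a • y + b) ≤ 2 ^ n * ∫⁻ y, f y := by
  have ha0 : a ≠ 0 := by linarith
  have h1 : ∫⁻ y, f (a • y + b) = ∫⁻ z, f (z + b) ∂(Measure.map (a • ·) (volume : Measure (Euc n))) := by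
    rw [lintegral_map (by fun_prop) (by fun_prop)]
  rw [h1, Measure.map_addHaar_smul _ ha0, lintegral_smul_measure, lintegral_add_right_eq_self]
  rw [smul_eq_mul]
  gcongr
  rw [show (2 : ℝ≥0∞) ^ n = ENNReal.ofReal (2 ^ n) by
    rw [ENNReal.ofReal_pow (by norm_num)]; norm_num]
  apply ENNReal.ofReal_le_ofReal
  rw [finrank_euclideanSpace, Fintype.card_fin, abs_of_nonneg (by positivity), ← inv_pow]
  apply pow_le_pow_left₀ (by positivity)
  rw [inv_le_comm₀ (by linarith) (by norm_num)]
  linarith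

theorem lp_core (Ω K : Set (Euc n)) (hΩ : volume Ω ≠ ⊤) (hK : volume K ≠ ⊤) (p : ℝ≥0∞) (hp : 1 ≤ p) :
    ∃ C : ℝ≥0∞, C ≠ ⊤ ∧ ∀ h : Euc n → ℝ≥0∞, Measurable h →
      eLpNorm (fun x => ∫⁻ t in Set.Ioc (0 : ℝ) 1, ∫⁻ y in K, h ((1 - t) • y + t • x)) p
        (volume.restrict Ω) ≤ C * eLpNorm h p volume := by
  rcases eq_or_ne p ⊤ with rfl | hpt
  · refine ⟨volume K, hK, fun h hh => ?_⟩
    rw [eLpNorm_exponent_top, eLpNorm_exponent_top]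
    apply eLpNormEssSup_le_of_ae_enorm_bound
    refine Filter.Eventually.of_forall fun x => ?_
    rw [enorm_eq_self]
    have hae : ∀ᵐ y, h y ≤ eLpNormEssSup h volume := ae_le_eLpNormEssSup
    have key : ∀ t ∈ Set.Ioo (0 : ℝ) 1, ∫⁻ y in K, h ((1 - t) • y + t • x) ≤
        volume K * eLpNormEssSup h volume := by
      intro t ht
      have hq : Measure.QuasiMeasurePreserving (fun y : Euc n => (1 - t) • y + t • x) volume volume := by
        refine (measurePreserving_add_right volume (t • x)).quasiMeasurePreserving.comp
          (f := fun y : Euc n => (1 - t) • y) ⟨by fun_prop, ?_⟩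
        rw [Measure.map_addHaar_smul _ (by linarith [ht.2])]
        exact Measure.smul_absolutelyContinuous
      have := hq.ae hae
      calc ∫⁻ y in K, h ((1 - t) • y + t • x) ≤ ∫⁻ y in K, eLpNormEssSup h volume :=
            lintegral_mono_ae (ae_restrict_of_ae this)
        _ = _ := by rw [setLIntegral_const, mul_comm]
    rw [← setLIntegral_congr Ioo_ae_eq_Ioc]
    refine (setLIntegral_mono' measurableSet_Ioo key).trans ?_
    simp
  · set q := p.toReal with hq
    have hp0 : p ≠ 0 := (zero_lt_one.trans_le hp).ne'
    have hq0 : 0 < q := ENNReal.toReal_pos hp0 hpt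
    have hq1 : 1 ≤ q := by
      have := ENNReal.toReal_mono hpt hp
      simpa using this
    set ν : Measure (ℝ × Euc n) := (volume.restrict (Set.Ioc (0 : ℝ) 1)).prod (volume.restrict K) with hν
    haveI : IsFiniteMeasure (volume.restrict K) := ⟨by simpa using hK.lt_top⟩
    haveI : IsFiniteMeasure (volume.restrict Ω) := ⟨by simpa using hΩ.lt_top⟩
    set D := ν Set.univ ^ (1 / (1 : ℝ≥0∞).toReal - 1 / q) with hD
    have hDt : D ≠ ⊤ := by
      apply ENNReal.rpow_ne_top_of_nonneg _ (measure_ne_top _ _)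
      have : 1 / q ≤ 1 := by rw [div_le_one hq0]; exact hq1
      simp at this ⊢; linarith
    set E := 2 ^ n * volume Ω + 2 ^ n * volume K with hE
    have hEt : E ≠ ⊤ := by
      simp only [hE]
      finiteness
    refine ⟨D * E ^ (1 / q), ENNReal.mul_ne_top hDt (ENNReal.rpow_ne_top_of_nonneg (by positivity) hEt), fun h hh => ?_⟩
    have hm : ∀ x, Measurable fun z : ℝ × Euc n => h ((1 - z.1) • z.2 + z.1 • x) := fun x =>
      hh.comp (by fun_prop)
    have hstep : ∀ x, (∫⁻ t in Set.Ioc (0 : ℝ) 1, ∫⁻ y in K, h ((1 - t) • y + t • x)) ≤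
        D * (∫⁻ z, h ((1 - z.1) • z.2 + z.1 • x) ^ q ∂ν) ^ (1 / q) := by
      intro x
      have h1 := eLpNorm_le_eLpNorm_mul_rpow_measure_univ (μ := ν) hp (hm x).aestronglyMeasurable
      rw [eLpNorm_one_eq_lintegral_enorm, eLpNorm_eq_lintegral_rpow_enorm_toReal hp0 hpt] at h1
      simp only [enorm_eq_self] at h1
      rw [mul_comm]
      refine le_trans (le_of_eq ?_) h1
      rw [lintegral_prod _ (hm x).aemeasurable]
    have hmain : ∫⁻ x in Ω, ∫⁻ z, h ((1 - z.1) • z.2 + z.1 • x) ^ q ∂ν ≤ E * ∫⁻ y, h y ^ q := by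
      have hm3 : Measurable fun w : Euc n × (ℝ × Euc n) =>
          h ((1 - w.2.1) • w.2.2 + w.2.1 • w.1) ^ q := (hh.comp (by fun_prop)).pow_const q
      rw [lintegral_lintegral_swap hm3.aemeasurable]
      have hm4 : Measurable fun z : ℝ × Euc n => ∫⁻ x in Ω, h ((1 - z.1) • z.2 + z.1 • x) ^ q :=
        Measurable.lintegral_prod_left' hm3
      rw [lintegral_prod _ hm4.aemeasurable]
      set H := ∫⁻ y, h y ^ q with hH
      have hpow : Measurable fun y => h y ^ q := hh.pow_const q
      have hb : ∀ t ∈ Set.Ioc (0 : ℝ) 1,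
          ∫⁻ y in K, ∫⁻ x in Ω, h ((1 - t) • y + t • x) ^ q ≤ E * H := by
        intro t ht
        rcases le_total t (1 / 2) with h2 | h2
        · rw [lintegral_lintegral_swap]
          · calc ∫⁻ x in Ω, ∫⁻ y in K, h ((1 - t) • y + t • x) ^ q
                ≤ ∫⁻ x in Ω, 2 ^ n * H := by
                  refine lintegral_mono fun x => ?_
                  refine (setLIntegral_le_lintegral _ _).trans ?_
                  exact lint_aff _ hpow (by linarith) _
              _ ≤ E * H := by
                  rw [setLIntegral_const, mul_right_comm]
                  gcongr
                  exact le_self_add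
          · exact ((hh.comp (by fun_prop)).pow_const q).aemeasurable
        · calc ∫⁻ y in K, ∫⁻ x in Ω, h ((1 - t) • y + t • x) ^ q
                ≤ ∫⁻ y in K, 2 ^ n * H := by
                  refine lintegral_mono fun y => ?_
                  refine (setLIntegral_le_lintegral _ _).trans ?_
                  simp only [add_comm ((1 - t) • y)]
                  exact lint_aff _ hpow (by linarith) _
              _ ≤ E * H := by
                  rw [setLIntegral_const, mul_right_comm]
                  gcongr
                  exact le_add_self
      refine (setLIntegral_mono' measurableSet_Ioc hb).trans ?_
      simp
    rw [eLpNorm_eq_lintegral_rpow_enorm_toReal hp0 hpt, eLpNorm_eq_lintegral_rpow_enorm_toReal hp0 hpt]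
    simp only [enorm_eq_self, ← hq]
    have hfin : ∫⁻ x in Ω, (∫⁻ t in Set.Ioc (0 : ℝ) 1, ∫⁻ y in K, h ((1 - t) • y + t • x)) ^ q ≤
        D ^ q * (E * ∫⁻ y, h y ^ q) := by
      calc _ ≤ ∫⁻ x in Ω, D ^ q * ∫⁻ z, h ((1 - z.1) • z.2 + z.1 • x) ^ q ∂ν := by
            refine lintegral_mono fun x => ?_
            refine (ENNReal.rpow_le_rpow (hstep x) hq0.le).trans ?_
            rw [ENNReal.mul_rpow_of_nonneg _ _ hq0.le, ← ENNReal.rpow_mul (z := q) (y := 1 / q),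
              one_div_mul_cancel hq0.ne', ENNReal.rpow_one]
        _ = D ^ q * ∫⁻ x in Ω, ∫⁻ z, h ((1 - z.1) • z.2 + z.1 • x) ^ q ∂ν := by
            rw [lintegral_const_mul' _ _ (ENNReal.rpow_ne_top_of_nonneg hq0.le hDt)]
        _ ≤ _ := by gcongr
    refine (ENNReal.rpow_le_rpow hfin (by positivity)).trans (le_of_eq ?_)
    rw [ENNReal.mul_rpow_of_nonneg _ _ (by positivity), ENNReal.mul_rpow_of_nonneg _ _ (by positivity),
      ← ENNReal.rpow_mul, mul_one_div_cancel hq0.ne', ENNReal.rpow_one, mul_assoc]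

/-- second term: a constant. -/
theorem lp_const (Ω K : Set (Euc n)) (hΩ : volume Ω ≠ ⊤) (hK : volume K ≠ ⊤) (p : ℝ≥0∞) (hp : 1 ≤ p) :
    ∃ C : ℝ≥0∞, C ≠ ⊤ ∧ ∀ h : Euc n → ℝ≥0∞, Measurable h →
      eLpNorm (fun _ : Euc n => ∫⁻ y in K, h y) p
        (volume.restrict Ω) ≤ C * eLpNorm h p volume := by
  haveI : IsFiniteMeasure (volume.restrict K) := ⟨by simpa using hK.lt_top⟩
  haveI : IsFiniteMeasure (volume.restrict Ω) := ⟨by simpa using hΩ.lt_top⟩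
  have hex : 0 ≤ 1 / (1 : ℝ≥0∞).toReal - 1 / p.toReal := by
    rcases eq_or_ne p ⊤ with rfl | hpt
    · simp
    · have h1 := ENNReal.toReal_mono hpt hp
      simp only [ENNReal.toReal_one, div_one] at h1 ⊢
      have : 1 / p.toReal ≤ 1 := by rw [div_le_one (by linarith)]; exact h1
      linarith
  refine ⟨(volume.restrict K) Set.univ ^ (1 / (1 : ℝ≥0∞).toReal - 1 / p.toReal) *
    (volume.restrict Ω) Set.univ ^ (1 / p.toReal), ?_, fun h hh => ?_⟩
  · exact ENNReal.mul_ne_top (ENNReal.rpow_ne_top_of_nonneg hex (measure_ne_top _ _))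
      (ENNReal.rpow_ne_top_of_nonneg (by positivity) (measure_ne_top _ _))
  · rcases eq_or_ne (volume.restrict Ω) 0 with h0 | h0
    · rw [h0, eLpNorm_measure_zero]
      exact zero_le
    rw [eLpNorm_const _ (zero_lt_one.trans_le hp).ne' h0, enorm_eq_self, mul_right_comm]
    gcongr
    have h1 := eLpNorm_le_eLpNorm_mul_rpow_measure_univ (μ := volume.restrict K) hp
      hh.aestronglyMeasurable
    rw [eLpNorm_one_eq_lintegral_enorm] at h1
    simp only [enorm_eq_self] at h1
    refine h1.trans ?_
    rw [mul_comm]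
    gcongr
    exact Measure.restrict_le_self

end Lp

section Fin
variable {n k : ℕ} {V W : Type*}
  [NormedAddCommGroup V] [InnerProductSpace ℝ V] [FiniteDimensional ℝ V]
  [NormedAddCommGroup W] [InnerProductSpace ℝ W] [FiniteDimensional ℝ W]

theorem localize {Ω : Set (Euc n)} (hΩ : IsOpen Ω) {u : Euc n → V}
    (hu : ∀ x ∈ Ω, ContDiffAt ℝ (⊤ : ℕ∞) u x) {L : Set (Euc n)} (hL : IsCompact L) (hLΩ : L ⊆ Ω) :
    ∃ v : Euc n → V, ContDiff ℝ (⊤ : ℕ∞) v ∧ ∀ y ∈ L, v =ᶠ[nhds y] u := by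
  obtain ⟨t, ht, hLt, htΩ⟩ := exists_compact_between hL hΩ hLΩ
  obtain ⟨f, hf1, hf0, -⟩ := exists_contMDiffMap_one_nhds_of_subset_interior
    (n := (⊤ : ℕ∞)) (modelWithCornersSelf ℝ (Euc n)) hL.isClosed hLt
  have hfs : ContDiff ℝ (⊤ : ℕ∞) (f : Euc n → ℝ) := f.contMDiff.contDiff
  refine ⟨fun y => f y • u y, ?_, fun y hy => ?_⟩
  · rw [contDiff_iff_contDiffAt]
    intro y
    by_cases hy : y ∈ Ω
    · exact hfs.contDiffAt.smul (hu y hy)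
    · have h0 : (fun y => f y • u y) =ᶠ[nhds y] fun _ => (0 : V) := by
        filter_upwards [ht.isClosed.isOpen_compl.mem_nhds (fun h => hy (htΩ h))] with z hz
        rw [hf0 z hz, zero_smul]
      exact contDiffAt_const.congr_of_eventuallyEq h0
  · have := hf1.filter_mono (nhds_le_nhdsSet hy)
    filter_upwards [this] with z hz
    rw [hz, one_smul]

theorem final (hn : 1 < n) (A : OpCoeff n k V W) (hA : IsCElliptic A)
    (Ω : Set (Euc n)) (hΩopen : IsOpen Ω) (hΩbdd : Bornology.IsBounded Ω)
    (hstar : ∃ x₀ : Euc n, ∃ r : ℝ, 0 < r ∧ ball x₀ r ⊆ Ω ∧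
      ∀ x ∈ Ω, ∀ y ∈ ball x₀ r, segment ℝ x y ⊆ Ω)
    (p : ℝ≥0∞) (hp : 1 ≤ p) (l : ℕ) (hl : l < k) :
    ∃ c : ℝ, 0 < c ∧ ∀ u : Euc n → V, ContDiffOn ℝ (⊤ : ℕ∞) u (closure Ω) →
      ∃ P : Euc n → V, ContDiff ℝ (⊤ : ℕ∞) P ∧ (∀ x, opApply A P x = 0) ∧
        eLpNorm (fun x => iteratedFDeriv ℝ l (fun y => u y - P y) x) p (volume.restrict Ω)
          ≤ ENNReal.ofReal c *
            eLpNorm (fun x => opApply A u x) p (volume.restrict Ω) := by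
  obtain ⟨x₀, r, hr, hball, hseg⟩ := hstar
  let f : ContDiffBump x₀ := ⟨r / 4, r / 2, by linarith, by linarith⟩
  set K : Set (Euc n) := closedBall x₀ (r / 2) with hKdef
  have hK : IsCompact K := isCompact_closedBall _ _
  have hKb : K ⊆ ball x₀ r := closedBall_subset_ball (by linarith)
  have hx₀K : x₀ ∈ K := mem_closedBall_self (by linarith)
  obtain ⟨R, hR⟩ := hΩbdd.subset_closedBall 0
  obtain ⟨C, hC0, Pm, hPs, hPA, hPloc, hPb⟩ := glob (by omega) A hA l hl (f.normed volume)
    f.contDiff_normed K hK (fun y hy => by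
      by_contra h
      have h1 : y ∈ Function.support (f.normed volume) := h
      rw [f.support_normed_eq] at h1
      exact hy (ball_subset_closedBall h1)) f.integral_normed R
  have hΩv : volume Ω ≠ ⊤ := hΩbdd.measure_lt_top.ne
  have hKv : volume K ≠ ⊤ := hK.measure_lt_top.ne
  obtain ⟨C1, hC1, hL1⟩ := lp_core Ω K hΩv hKv p hp
  obtain ⟨C2, hC2, hL2⟩ := lp_const Ω K hΩv hKv p hp
  set D : ℝ≥0∞ := (C1 + C2) * ENNReal.ofReal C with hD
  have hDt : D ≠ ⊤ := by simp only [hD]; finiteness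
  refine ⟨D.toReal + 1, by positivity, fun u hu => ?_⟩
  have hu' : ∀ x ∈ Ω, ContDiffAt ℝ (⊤ : ℕ∞) u x := fun x hx =>
    hu.contDiffAt (Filter.mem_of_superset (hΩopen.mem_nhds hx) subset_closure)
  obtain ⟨v₀, hv₀, hv₀u⟩ := localize hΩopen hu' hK (hKb.trans hball)
  refine ⟨Pm v₀, hPs _, hPA _, ?_⟩
  set g : Euc n → W := fun x => C • opApply A u x with hg
  set h : Euc n → ℝ≥0∞ := Ω.indicator fun x => ‖g x‖ₑ with hh
  have hgc : ContinuousOn g Ω := by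
    intro x hx
    refine ContinuousAt.continuousWithinAt ?_
    have h1 : ContDiffAt ℝ 0 (iteratedFDeriv ℝ k u) x :=
      (hu' x hx).iteratedFDeriv_right (by simpa using (by exact_mod_cast le_top))
    exact (A.continuous.continuousAt.comp h1.continuousAt).const_smul C
  have hhm : Measurable h := by
    classical
    have := ContinuousOn.measurable_piecewise (f := fun x => ‖g x‖ₑ) (g := fun _ => (0 : ℝ≥0∞))
      (s := Ω) hgc.enorm continuousOn_const hΩopen.measurableSet
    rwa [show (fun _ : Euc n => (0 : ℝ≥0∞)) = 0 from rfl, Set.piecewise_eq_indicator] at this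
  have hhn : eLpNorm h p volume = ENNReal.ofReal C * eLpNorm (fun x => opApply A u x) p (volume.restrict Ω) := by
    rw [hh, eLpNorm_indicator_eq_eLpNorm_restrict hΩopen.measurableSet, eLpNorm_enorm]
    have := eLpNorm_const_smul C (fun x => opApply A u x) p (volume.restrict Ω)
    rw [Real.enorm_eq_ofReal hC0] at this
    exact this
  have hpt : ∀ x ∈ Ω, ‖iteratedFDeriv ℝ l (fun y => u y - Pm v₀ y) x‖ₑ ≤
      (∫⁻ t in Set.Ioc (0 : ℝ) 1, ∫⁻ y in K, h ((1 - t) • y + t • x)) + ∫⁻ y in K, h y := by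
    intro x hx
    have hin : ∀ t ∈ Set.Icc (0 : ℝ) 1, ∀ y ∈ K, (1 - t) • y + t • x ∈ Ω := by
      intro t ht y hy
      refine hseg x hx y (hKb hy) ?_
      exact ⟨t, 1 - t, ht.1, by linarith [ht.2], by ring, by rw [add_comm]⟩
    set L : Set (Euc n) := (fun z : ℝ × Euc n => (1 - z.1) • z.2 + z.1 • x) '' (Set.Icc 0 1 ×ˢ K) with hLdef
    have hLc : IsCompact L := (isCompact_Icc.prod hK).image (by fun_prop)
    have hLΩ : L ⊆ Ω := by
      rintro _ ⟨⟨t, y⟩, ⟨ht, hy⟩, rfl⟩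
      exact hin t ht y hy
    have hxL : x ∈ L := ⟨(1, x₀), ⟨by simp, hx₀K⟩, by simp⟩
    have hKL : K ⊆ L := fun y hy => ⟨(0, y), ⟨by simp, hy⟩, by simp⟩
    obtain ⟨v, hv, hvu⟩ := localize hΩopen hu' hLc hLΩ
    have hPv : Pm v₀ = Pm v := hPloc _ _ fun y hy => (hv₀u y hy).trans (hvu y (hKL hy)).symm
    have hopv : ∀ y ∈ L, opApply A v y = opApply A u y := fun y hy => by
      simp only [opApply]
      rw [((hvu y hy).iteratedFDeriv ℝ k).eq_of_nhds]
    have e1 : iteratedFDeriv ℝ l (fun y => u y - Pm v₀ y) x =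
        iteratedFDeriv ℝ l v x - iteratedFDeriv ℝ l (Pm v) x := by
      have h1 : (fun y => u y - Pm v₀ y) =ᶠ[nhds x] fun y => v y - Pm v y := by
        filter_upwards [hvu x hxL] with y hy
        rw [hPv, hy]
      rw [(h1.iteratedFDeriv ℝ l).eq_of_nhds]
      exact iteratedFDeriv_sub_apply (hv.contDiffAt.of_le (by exact_mod_cast le_top))
        ((hPs v).contDiffAt.of_le (by exact_mod_cast le_top))
    have e2 := hPb v hv x (by simpa using hR hx)
    rw [e1, ← ofReal_norm]
    refine (ENNReal.ofReal_le_ofReal e2).trans (ENNReal.ofReal_add_le.trans ?_)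
    have hgv : ∀ y ∈ L, ‖C • ‖opApply A v y‖‖ₑ = h y := by
      intro y hy
      rw [hopv y hy, hh, Set.indicator_of_mem (hLΩ hy), hg, enorm_smul, enorm_smul, enorm_norm]
    refine add_le_add ?_ ?_
    · rw [← integral_const_mul]
      simp only [← integral_const_mul]
      refine (Real.ofReal_le_enorm _).trans ((enorm_integral_le_lintegral_enorm _).trans ?_)
      refine setLIntegral_mono' measurableSet_Ioc fun t ht => ?_
      refine (enorm_integral_le_lintegral_enorm _).trans ?_
      refine setLIntegral_mono' hK.measurableSet fun y hy => le_of_eq ?_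
      exact hgv _ ⟨(t, y), ⟨⟨ht.1.le, ht.2⟩, hy⟩, rfl⟩
    · rw [← integral_const_mul]
      refine (Real.ofReal_le_enorm _).trans ((enorm_integral_le_lintegral_enorm _).trans ?_)
      exact setLIntegral_mono' hK.measurableSet fun y hy => le_of_eq (hgv y (hKL hy))
  set F : Euc n → ℝ≥0∞ := fun x => ∫⁻ t in Set.Ioc (0 : ℝ) 1, ∫⁻ y in K, h ((1 - t) • y + t • x) with hF
  have hFm : Measurable F := by
    have h3 : Measurable fun w : (Euc n × ℝ) × Euc n => h ((1 - w.1.2) • w.2 + w.1.2 • w.1.1) :=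
      hhm.comp (by fun_prop)
    exact Measurable.lintegral_prod_right' (Measurable.lintegral_prod_right' h3)
  calc _ ≤ eLpNorm (F + fun _ => ∫⁻ y in K, h y) p (volume.restrict Ω) := by
        refine eLpNorm_mono_enorm_ae ?_
        filter_upwards [ae_restrict_mem hΩopen.measurableSet] with x hx
        exact hpt x hx
    _ ≤ eLpNorm F p (volume.restrict Ω) + eLpNorm (fun _ => ∫⁻ y in K, h y) p (volume.restrict Ω) :=
        eLpNorm_add_le hFm.aestronglyMeasurable aestronglyMeasurable_const hp
    _ ≤ C1 * eLpNorm h p volume + C2 * eLpNorm h p volume := add_le_add (hL1 h hhm) (hL2 h hhm)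
    _ = D * eLpNorm (fun x => opApply A u x) p (volume.restrict Ω) := by
        rw [← add_mul, hhn, hD, mul_assoc]
    _ ≤ _ := by
        gcongr
        rw [← ENNReal.ofReal_toReal hDt]
        apply ENNReal.ofReal_le_ofReal
        rw [ENNReal.toReal_ofReal ENNReal.toReal_nonneg]
        linarith
end Fin

/-- (Poincaré-type inequality.) Let `𝔸` be ℂ-elliptic of order `k`, let
`Ω ⊂ ℝⁿ` be a bounded open set star-shaped with respect to an open ball contained in it,
`1 ≤ p ≤ ∞` and `0 ≤ l < k`. Then there is `c > 0` such that every `u ∈ C^∞(cl Ω, V)`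
admits `P ∈ C^∞(ℝⁿ, V)` with `𝔸 P = 0` on `ℝⁿ` and
`‖D^l (u − P)‖_{L^p(Ω)} ≤ c ‖𝔸 u‖_{L^p(Ω)}`. -/
theorem statement14 (hn : 1 < n) (A : OpCoeff n k V W) (hA : IsCElliptic A)
    (Ω : Set (Euc n)) (hΩopen : IsOpen Ω) (hΩbdd : Bornology.IsBounded Ω)
    (hstar : ∃ x₀ : Euc n, ∃ r : ℝ, 0 < r ∧ ball x₀ r ⊆ Ω ∧
      ∀ x ∈ Ω, ∀ y ∈ ball x₀ r, segment ℝ x y ⊆ Ω)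
    (p : ℝ≥0∞) (hp : 1 ≤ p) (l : ℕ) (hl : l < k) :
    ∃ c : ℝ, 0 < c ∧ ∀ u : Euc n → V, ContDiffOn ℝ (⊤ : ℕ∞) u (closure Ω) →
      ∃ P : Euc n → V, ContDiff ℝ (⊤ : ℕ∞) P ∧ (∀ x, opApply A P x = 0) ∧
        eLpNorm (fun x => iteratedFDeriv ℝ l (fun y => u y - P y) x) p (volume.restrict Ω)
          ≤ ENNReal.ofReal c *
            eLpNorm (fun x => opApply A u x) p (volume.restrict Ω) := by
  exact final hn A hA Ω hΩopen hΩbdd hstar p hp l hl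
end
end

section
/- Let n>1, let 𝔸 be a first-order (k=1) elliptic homogeneous linear constant-coefficient differential operator on ℝⁿ from V to W, and fix R > 0 and 0 < s < 1. Then for every 1 ≤ p < n/(n−1+s) there exists a constant c = c(s, R, p, 𝔸) > 0 such that for every u ∈ C_c^∞(ℝⁿ, V) with support contained in the closed ball B(0,R), and for every y ∈ ℝⁿ, ∫_{ℝⁿ} |u(x+y) − u(x)|^p dx ≤ c ‖𝔸u‖_{L¹(ℝⁿ)}^p |y|^{sp}. -/
noncomputable section

open MeasureTheory Metric
open scoped ENNReal RealInnerProductSpace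

variable {n k : ℕ} {V W : Type*}
  [NormedAddCommGroup V] [InnerProductSpace ℝ V] [FiniteDimensional ℝ V]
  [NormedAddCommGroup W] [InnerProductSpace ℝ W] [FiniteDimensional ℝ W]

set_option linter.unusedSectionVars false

open scoped SchwartzMap FourierTransform Topology
open Filter

lemma aux_schwartz_decay {m : ℕ} (G : 𝓢(Euc m, ℂ)) {s θ : ℝ} (hs1 : s < 1)
    (hθ : 0 ≤ θ) : ∃ C : ℝ, 0 ≤ C ∧ ∀ a : Euc m, a ≠ 0 →
      ‖G a‖ ^ (1 - s) ≤ C * ‖a‖ ^ (-θ) := by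
  obtain ⟨N, hN⟩ := exists_nat_ge (θ / (1 - s))
  have h1s : 0 < 1 - s := by linarith
  have hN' : θ ≤ N * (1 - s) := by rwa [div_le_iff₀ h1s] at hN
  obtain ⟨C0, hC0⟩ : ∃ C0 : ℝ, ∀ x, (1 + ‖x‖) ^ N * ‖G x‖ ≤ C0 := by
    have := SchwartzMap.one_add_le_sup_seminorm_apply (𝕜 := ℝ) (m := (N, 0)) (k := N) (n := 0)
      le_rfl le_rfl G
    simp_rw [norm_iteratedFDeriv_zero] at this
    exact ⟨_, this⟩
  have hC0' : 0 ≤ C0 := le_trans (by positivity) (hC0 0)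
  refine ⟨C0 ^ (1 - s), by positivity, fun a ha => ?_⟩
  have ha' : 0 < ‖a‖ := norm_pos_iff.2 ha
  have hb : 0 < 1 + ‖a‖ := by positivity
  have h1 : ‖G a‖ ≤ C0 * ((1 + ‖a‖) ^ N)⁻¹ := by
    rw [← div_eq_mul_inv, le_div_iff₀ (by positivity)]
    linarith [hC0 a]
  calc ‖G a‖ ^ (1 - s) ≤ (C0 * ((1 + ‖a‖) ^ N)⁻¹) ^ (1 - s) := by gcongr
    _ = C0 ^ (1 - s) * (1 + ‖a‖) ^ (-(N * (1 - s))) := by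
        rw [Real.mul_rpow hC0' (by positivity), Real.inv_rpow (by positivity),
          ← Real.rpow_natCast, ← Real.rpow_mul hb.le, Real.rpow_neg hb.le]
    _ ≤ C0 ^ (1 - s) * (1 + ‖a‖) ^ (-θ) := by
        gcongr
        linarith
    _ ≤ C0 ^ (1 - s) * ‖a‖ ^ (-θ) := by
        refine mul_le_mul_of_nonneg_left ?_ (by positivity)
        exact Real.rpow_le_rpow_of_nonpos ha' (le_add_of_nonneg_left zero_le_one) (neg_nonpos.2 hθ)

lemma aux_schwartz_holder {m : ℕ} (G : 𝓢(Euc m, ℂ)) {s θ : ℝ} (hs0 : 0 < s) (hs1 : s < 1)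
    (hθ : 0 ≤ θ) : ∃ C : ℝ, 0 ≤ C ∧ ∀ a b : Euc m, a ≠ 0 → b ≠ 0 →
      ‖G a - G b‖ ≤ C * ‖a - b‖ ^ s * (‖a‖ ^ (-θ) + ‖b‖ ^ (-θ)) := by
  obtain ⟨C, hC, h⟩ := aux_schwartz_decay G hs1 hθ
  obtain ⟨L, hL, hL'⟩ := G.decay 0 1
  have hlip : ∀ a b, ‖G a - G b‖ ≤ L * ‖a - b‖ := by
    intro a b
    refine Convex.norm_image_sub_le_of_norm_fderiv_le (𝕜 := ℝ) (s := Set.univ)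
      (fun x _ => G.differentiableAt) (fun x _ => ?_) convex_univ trivial trivial
    have := hL' x
    rw [pow_zero, one_mul, norm_iteratedFDeriv_one] at this
    exact this
  refine ⟨L ^ s * C, by positivity, fun a b ha hb => ?_⟩
  have h1s : 0 < 1 - s := by linarith
  calc ‖G a - G b‖ = ‖G a - G b‖ ^ s * ‖G a - G b‖ ^ (1 - s) := by
        rcases (norm_nonneg (G a - G b)).eq_or_lt with h0 | h0
        · rw [← h0, Real.zero_rpow hs0.ne', zero_mul]
        · rw [← Real.rpow_add h0]; simp
    _ ≤ (L * ‖a - b‖) ^ s * (‖G a‖ + ‖G b‖) ^ (1 - s) := by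
        gcongr
        · exact hlip a b
        · exact norm_sub_le _ _
    _ ≤ (L ^ s * ‖a - b‖ ^ s) * (‖G a‖ ^ (1 - s) + ‖G b‖ ^ (1 - s)) := by
        rw [Real.mul_rpow hL.le (norm_nonneg _)]
        gcongr
        exact Real.rpow_add_le_add_rpow (norm_nonneg _) (norm_nonneg _) h1s.le (by linarith)
    _ ≤ (L ^ s * ‖a - b‖ ^ s) * (C * ‖a‖ ^ (-θ) + C * ‖b‖ ^ (-θ)) := by
        gcongr
        · exact h a ha
        · exact h b hb
    _ = _ := by ring

lemma aux_scale {m : ℕ} (G : 𝓢(Euc m, ℂ)) {s θ : ℝ} (hs0 : 0 < s) (hs1 : s < 1)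
    (hθ : 0 ≤ θ) : ∃ C : ℝ, 0 ≤ C ∧ ∀ a b : Euc m, a ≠ 0 → b ≠ 0 → ∀ t : ℝ, 0 < t →
      t * (t ^ m)⁻¹ * ‖G (t⁻¹ • a) - G (t⁻¹ • b)‖ ≤
        C * t ^ (θ - (m - 1 + s)) * ‖a - b‖ ^ s * (‖a‖ ^ (-θ) + ‖b‖ ^ (-θ)) := by
  obtain ⟨C, hC, h⟩ := aux_schwartz_holder G hs0 hs1 hθ
  refine ⟨C, hC, fun a b ha hb t ht => ?_⟩
  have h1 := h (t⁻¹ • a) (t⁻¹ • b) (by simp [ht.ne', ha]) (by simp [ht.ne', hb])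
  rw [← smul_sub, norm_smul, norm_smul, norm_smul, Real.norm_of_nonneg (inv_nonneg.2 ht.le),
    Real.mul_rpow (by positivity) (by positivity), Real.mul_rpow (by positivity) (by positivity),
    Real.mul_rpow (by positivity) (by positivity), Real.inv_rpow ht.le, Real.inv_rpow ht.le,
    Real.rpow_neg ht.le, inv_inv] at h1
  have h2 : t ^ (θ - (m - 1 + s)) = t * (t ^ m)⁻¹ * (t ^ s)⁻¹ * t ^ θ := by
    rw [show θ - ((m : ℝ) - 1 + s) = 1 + (-(m : ℝ)) + (-s) + θ by ring, Real.rpow_add ht,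
      Real.rpow_add ht, Real.rpow_add ht, Real.rpow_one, Real.rpow_neg ht.le, Real.rpow_neg ht.le,
      Real.rpow_natCast]
  rw [h2]
  refine (mul_le_mul_of_nonneg_left h1 (by positivity)).trans (le_of_eq ?_)
  ring

lemma aux_geom {q : ℝ} (hq : 0 < q) (J : ℕ) :
    ∑ j ∈ Finset.range J, ((2 : ℝ) ^ j) ^ (-q) ≤ (1 - 2 ^ (-q))⁻¹ := by
  have h0 : (0 : ℝ) ≤ 2 ^ (-q) := by positivity
  have h1 : (2 : ℝ) ^ (-q) < 1 := Real.rpow_lt_one_of_one_lt_of_neg (by norm_num) (by linarith)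
  have : ∀ j : ℕ, ((2 : ℝ) ^ j) ^ (-q) = (2 ^ (-q)) ^ j := fun j => by
    rw [← Real.rpow_natCast, ← Real.rpow_mul (by norm_num), mul_comm, Real.rpow_mul (by norm_num),
      Real.rpow_natCast]
  simp_rw [this]
  rw [← tsum_geometric_of_lt_one h0 h1]
  exact (summable_geometric_of_lt_one h0 h1).sum_le_tsum _ (fun _ _ => by positivity)

lemma aux_kernel_sum {m : ℕ} (hm : 1 < m) (G : 𝓢(Euc m, ℂ)) {s β : ℝ} (hs0 : 0 < s) (hs1 : s < 1)
    (hβ : (m : ℝ) - 1 + s < β) : ∃ C : ℝ, 0 ≤ C ∧ ∀ a b : Euc m, a ≠ 0 → b ≠ 0 → ∀ J : ℕ,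
      ∑ j ∈ Finset.range J,
        ((2 ^ j : ℝ) * ((2 ^ j : ℝ) ^ m)⁻¹ * ‖G ((2 ^ j : ℝ)⁻¹ • a) - G ((2 ^ j : ℝ)⁻¹ • b)‖
        + ((2 ^ (j + 1) : ℝ)⁻¹) * (((2 ^ (j + 1) : ℝ)⁻¹) ^ m)⁻¹ *
          ‖G (((2 ^ (j + 1) : ℝ)⁻¹)⁻¹ • a) - G (((2 ^ (j + 1) : ℝ)⁻¹)⁻¹ • b)‖) ≤
        C * ‖a - b‖ ^ s * (1 + ‖a‖ ^ (-β) + ‖b‖ ^ (-β)) := by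
  have hm' : (1 : ℝ) < m := by exact_mod_cast hm
  have hα : 0 < (m : ℝ) - 1 + s := by linarith
  obtain ⟨C₁, hC₁, h₁⟩ := aux_scale G hs0 hs1 (le_refl (0 : ℝ))
  obtain ⟨C₂, hC₂, h₂⟩ := aux_scale G hs0 hs1 (θ := β) (by linarith)
  set α : ℝ := (m : ℝ) - 1 + s
  have hq1 : (2 : ℝ) ^ (-α) < 1 := Real.rpow_lt_one_of_one_lt_of_neg (by norm_num) (by linarith)
  have hq2 : (2 : ℝ) ^ (-(β - α)) < 1 :=
    Real.rpow_lt_one_of_one_lt_of_neg (by norm_num) (by linarith)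
  set D₁ := (1 - (2 : ℝ) ^ (-α))⁻¹
  set D₂ := (1 - (2 : ℝ) ^ (-(β - α)))⁻¹
  have hD₁ : 0 ≤ D₁ := inv_nonneg.2 (by linarith)
  have hD₂ : 0 ≤ D₂ := inv_nonneg.2 (by linarith)
  refine ⟨2 * C₁ * D₁ + C₂ * D₂, by positivity, fun a b ha hb J => ?_⟩
  rw [Finset.sum_add_distrib]
  have e1 := calc
    ∑ j ∈ Finset.range J,
        (2 ^ j : ℝ) * ((2 ^ j : ℝ) ^ m)⁻¹ * ‖G ((2 ^ j : ℝ)⁻¹ • a) - G ((2 ^ j : ℝ)⁻¹ • b)‖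
      ≤ ∑ j ∈ Finset.range J, (2 * C₁ * ‖a - b‖ ^ s) * ((2 : ℝ) ^ j) ^ (-α) := by
        refine Finset.sum_le_sum fun j _ => (h₁ a b ha hb (2 ^ j) (by positivity)).trans (le_of_eq ?_)
        simp only [neg_zero, Real.rpow_zero, zero_sub]
        ring
    _ ≤ (2 * C₁ * ‖a - b‖ ^ s) * D₁ := by
        rw [← Finset.mul_sum]
        gcongr
        exact aux_geom hα J
  have e2 := calc
    ∑ j ∈ Finset.range J, ((2 ^ (j + 1) : ℝ)⁻¹) * (((2 ^ (j + 1) : ℝ)⁻¹) ^ m)⁻¹ *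
          ‖G (((2 ^ (j + 1) : ℝ)⁻¹)⁻¹ • a) - G (((2 ^ (j + 1) : ℝ)⁻¹)⁻¹ • b)‖
      ≤ ∑ j ∈ Finset.range J,
        (C₂ * ‖a - b‖ ^ s * (‖a‖ ^ (-β) + ‖b‖ ^ (-β))) * ((2 : ℝ) ^ j) ^ (-(β - α)) := by
        refine Finset.sum_le_sum fun j _ =>
          (h₂ a b ha hb ((2 ^ (j + 1))⁻¹) (by positivity)).trans ?_
        rw [Real.inv_rpow (by positivity), ← Real.rpow_neg (by positivity)]
        have : ((2 : ℝ) ^ (j + 1)) ^ (-(β - α)) ≤ ((2 : ℝ) ^ j) ^ (-(β - α)) := by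
          apply Real.rpow_le_rpow_of_nonpos (by positivity) _ (by linarith)
          gcongr <;> norm_num
        calc _ = (C₂ * ‖a - b‖ ^ s * (‖a‖ ^ (-β) + ‖b‖ ^ (-β))) * ((2 : ℝ) ^ (j + 1)) ^ (-(β - α)) := by ring
          _ ≤ _ := by gcongr
    _ ≤ (C₂ * ‖a - b‖ ^ s * (‖a‖ ^ (-β) + ‖b‖ ^ (-β))) * D₂ := by
        rw [← Finset.mul_sum]
        gcongr
        exact aux_geom (by linarith) J
  have hX : 0 ≤ ‖a - b‖ ^ s := by positivity
  have hY : 0 ≤ ‖a‖ ^ (-β) + ‖b‖ ^ (-β) := by positivity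
  refine (add_le_add e1 e2).trans ?_
  have h3 : 0 ≤ C₁ * D₁ * ‖a - b‖ ^ s * (‖a‖ ^ (-β) + ‖b‖ ^ (-β)) := by positivity
  have h4 : 0 ≤ C₂ * D₂ * ‖a - b‖ ^ s := by positivity
  nlinarith

lemma aux_swap {m : ℕ} (M f : 𝓢(Euc m, ℂ)) (x : Euc m) {t : ℝ} (ht : 0 < t) :
    ∫ ξ, ((𝐞 ⟪ξ, x⟫ : Circle) : ℂ) * (M (t • ξ) * 𝓕 f ξ) =
      ∫ z, f z * (((t ^ m)⁻¹ : ℝ) * 𝓕 M (t⁻¹ • (z - x))) := by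
  have hMt : Integrable (fun ξ : Euc m => M (t • ξ)) :=
    (integrable_comp_smul_iff volume M ht.ne').2 M.integrable
  have hg : Integrable (fun ξ : Euc m => ((𝐞 ⟪ξ, x⟫ : Circle) : ℂ) * M (t • ξ)) := by
    refine (hMt.bdd_mul (c := 1) (f := fun ξ : Euc m => ((𝐞 ⟪ξ, x⟫ : Circle) : ℂ)) ?_ ?_)
    · apply Continuous.aestronglyMeasurable
      fun_prop
    · exact Eventually.of_forall fun ξ => (Circle.norm_coe _).le
  have key := VectorFourier.integral_fourierIntegral_smul_eq_flip (L := innerₗ (Euc m))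
      (μ := volume) (ν := volume)
      Real.continuous_fourierChar continuous_inner f.integrable hg
  have e1 : ∀ ξ : Euc m, ((𝐞 ⟪ξ, x⟫ : Circle) : ℂ) * (M (t • ξ) * 𝓕 f ξ) =
     (VectorFourier.fourierIntegral 𝐞 volume (innerₗ (Euc m)) f ξ) •
       (((𝐞 ⟪ξ, x⟫ : Circle) : ℂ) * M (t • ξ)) := by
    intro ξ
    rw [smul_eq_mul]
    rw [SchwartzMap.fourier_coe]
    change _ = 𝓕 (f : Euc m → ℂ) ξ * _
    ring
  simp_rw [e1]
  rw [key]
  congr 1 with z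
  rw [smul_eq_mul]
  congr 1
  rw [flip_innerₗ, SchwartzMap.fourier_coe]
  change 𝓕 (fun ξ : Euc m => ((𝐞 ⟪ξ, x⟫ : Circle) : ℂ) * M (t • ξ)) z = _
  rw [Real.fourier_eq, Real.fourier_eq]
  have e2 : ∀ ξ : Euc m, 𝐞 (-⟪ξ, z⟫) • (((𝐞 ⟪ξ, x⟫ : Circle) : ℂ) * M (t • ξ)) =
      (fun η : Euc m => 𝐞 (-⟪η, t⁻¹ • (z - x)⟫) • M η) (t • ξ) := by
    intro ξ
    simp only [Circle.smul_def, smul_eq_mul]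
    rw [← mul_assoc, ← Circle.coe_mul, ← AddChar.map_add_eq_mul]
    congr 4
    rw [inner_smul_left, inner_smul_right, inner_sub_right]
    simp only [conj_trivial]
    field_simp
    ring
  simp_rw [e2]
  rw [Measure.integral_comp_smul_of_nonneg volume
    (fun η : Euc m => 𝐞 (-⟪η, t⁻¹ • (z - x)⟫) • M η) t (hR := ht.le)]
  simp


lemma aux_symTensor_apply (ξ : Euc n) (v : V) (e : Fin 1 → Euc n) :
    symTensor n 1 ξ v e = ⟪ξ, e 0⟫ • v := by
  simp [symTensor]

/-- The symbol as a bilinear map. -/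
def auxSymbolLM (A : OpCoeff n 1 V W) : Euc n →ₗ[ℝ] V →ₗ[ℝ] W :=
  LinearMap.mk₂ ℝ (symbol A)
    (fun x y v => by
      rw [symbol, symbol, symbol, ← map_add]; congr 1; ext e
      simp [aux_symTensor_apply, inner_add_left, add_smul])
    (fun c x v => by
      rw [symbol, symbol, ← map_smul]; congr 1; ext e
      simp [aux_symTensor_apply, inner_smul_left, mul_smul])
    (fun x v w => by
      rw [symbol, symbol, symbol, ← map_add]; congr 1; ext e
      simp [aux_symTensor_apply])
    (fun c x v => by
      rw [symbol, symbol, ← map_smul]; congr 1; ext e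
      simp [aux_symTensor_apply, smul_comm c])

/-- The symbol as a linear map to continuous linear maps. -/
def auxSymbolCLM (A : OpCoeff n 1 V W) : Euc n →L[ℝ] (V →L[ℝ] W) :=
  LinearMap.toContinuousLinearMap
    ((LinearMap.toContinuousLinearMap (𝕜 := ℝ) (E := V) (F' := W)).toLinearMap ∘ₗ auxSymbolLM A)

lemma auxSymbolCLM_apply (A : OpCoeff n 1 V W) (ξ : Euc n) (v : V) :
    auxSymbolCLM A ξ v = symbol A ξ v := rfl

lemma aux_left_inverse (A : OpCoeff n 1 V W) (hA : IsElliptic A) :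
    ∃ N : Euc n → (W →L[ℝ] V), (∀ ξ, ξ ≠ 0 → ContDiffAt ℝ (⊤ : ℕ∞) N ξ) ∧
      ∀ ξ, ξ ≠ 0 → ∀ v, N ξ (symbol A ξ v) = v := by
  let adj : (V →L[ℝ] W) →L[ℝ] (W →L[ℝ] V) :=
    LinearMap.toContinuousLinearMap
      { toFun := fun T => ContinuousLinearMap.adjoint T
        map_add' := fun x y => by simp
        map_smul' := fun c x => by simp }
  have hadj : ∀ T, adj T = ContinuousLinearMap.adjoint T := fun _ => rfl
  let B := auxSymbolCLM A
  let P : Euc n → (V →L[ℝ] V) := fun ξ => (adj (B ξ)).comp (B ξ)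
  have hP : ContDiff ℝ (⊤ : ℕ∞) P :=
    (adj.contDiff.comp B.contDiff).clm_comp B.contDiff
  have hunit : ∀ ξ, ξ ≠ 0 → IsUnit (P ξ) := by
    intro ξ hξ
    have hinj : Function.Injective (P ξ).toLinearMap := by
      rw [← LinearMap.ker_eq_bot, LinearMap.ker_eq_bot']
      intro v hv
      have h1 : ⟪P ξ v, v⟫ = 0 := by
        have : P ξ v = 0 := hv
        rw [this, inner_zero_left]
      have h2 : ⟪P ξ v, v⟫ = ⟪B ξ v, B ξ v⟫ := by
        change ⟪adj (B ξ) (B ξ v), v⟫ = _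
        rw [hadj, ContinuousLinearMap.adjoint_inner_left]
      rw [h2, inner_self_eq_zero] at h1
      apply hA ξ hξ
      change B ξ v = B ξ 0
      rw [h1, map_zero]
    have hb : Function.Bijective (P ξ) := ⟨hinj, LinearMap.injective_iff_surjective.1 hinj⟩
    exact ContinuousLinearMap.isUnit_iff_bijective.2 hb
  refine ⟨fun ξ => (Ring.inverse (P ξ)).comp (adj (B ξ)), fun ξ hξ => ?_, fun ξ hξ v => ?_⟩
  · obtain ⟨U, hU⟩ := hunit ξ hξ
    have h1 : ContDiffAt ℝ (⊤ : ℕ∞) (Ring.inverse : (V →L[ℝ] V) → _) (P ξ) := by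
      rw [← hU]; exact contDiffAt_ringInverse ℝ U
    exact (h1.comp ξ hP.contDiffAt).clm_comp (adj.contDiff.comp B.contDiff).contDiffAt
  · have := Ring.inverse_mul_cancel _ (hunit ξ hξ)
    have h2 := congrArg (fun T : V →L[ℝ] V => T v) this
    exact h2

/-- A smooth bump at the origin. -/
def auxBump (m : ℕ) : ContDiffBump (0 : Euc m) := ⟨1, 2, one_pos, one_lt_two⟩

lemma aux_multiplier {ι κ : Type*} [Fintype ι] [Fintype κ]
    (b : OrthonormalBasis ι ℝ V) (w : OrthonormalBasis κ ℝ W)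
    (A : OpCoeff n 1 V W) (hA : IsElliptic A) :
    ∃ M : ι → κ → 𝓢(Euc n, ℂ), ∀ l η v, ∑ k, M l k η * ((⟪w k, symbol A η v⟫ : ℝ) : ℂ) =
      ((auxBump n η - auxBump n ((2 : ℝ) • η) : ℝ) : ℂ) * ((⟪b l, v⟫ : ℝ) : ℂ) := by
  obtain ⟨N, hN, hN'⟩ := aux_left_inverse A hA
  let ψ : Euc n → ℝ := fun η => auxBump n η - auxBump n ((2 : ℝ) • η)
  have hψ : ContDiff ℝ (⊤ : ℕ∞) ψ :=
    (auxBump n).contDiff.sub ((auxBump n).contDiff.comp (contDiff_const_smul _))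
  have hψ0 : ∀ η : Euc n, ‖η‖ < 1 / 2 → ψ η = 0 := by
    intro η hη
    have h1 : auxBump n η = 1 := (auxBump n).one_of_mem_closedBall (by
      simp only [mem_closedBall, dist_zero_right]; change ‖η‖ ≤ 1; linarith)
    have h2 : auxBump n ((2 : ℝ) • η) = 1 := (auxBump n).one_of_mem_closedBall (by
      simp only [mem_closedBall, dist_zero_right]; change ‖(2 : ℝ) • η‖ ≤ 1
      rw [norm_smul]; norm_num; linarith)
    simp only [ψ, h1, h2, sub_self]
  have hψc : HasCompactSupport ψ := by
    refine (auxBump n).hasCompactSupport.sub ?_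
    exact (auxBump n).hasCompactSupport.comp_homeomorph
      (Homeomorph.smulOfNeZero (2 : ℝ) (by norm_num))
  let M0 : ι → κ → Euc n → ℂ := fun l k η => ((ψ η * ⟪b l, N η (w k)⟫ : ℝ) : ℂ)
  have hM1 : ∀ l k, HasCompactSupport (M0 l k) := by
    intro l k
    have : HasCompactSupport (fun η => ψ η * ⟪b l, N η (w k)⟫) := hψc.mul_right
    exact this.comp_left (g := Complex.ofReal) Complex.ofReal_zero
  have hM2 : ∀ l k, ContDiff ℝ (⊤ : ℕ∞) (M0 l k) := by
    intro l k
    refine Complex.ofRealCLM.contDiff.comp (f := fun η => ψ η * ⟪b l, N η (w k)⟫) ?_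
    rw [contDiff_iff_contDiffAt]
    intro η
    by_cases hη : η = 0
    · subst hη
      refine (contDiffAt_const (c := (0 : ℝ))).congr_of_eventuallyEq ?_
      filter_upwards [Metric.ball_mem_nhds (0 : Euc n) (show (0 : ℝ) < 1 / 2 by norm_num)] with η hη
      rw [hψ0 η (by simpa using hη), zero_mul]
    · refine hψ.contDiffAt.mul ?_
      exact contDiffAt_const.inner ℝ ((hN η hη).clm_apply contDiffAt_const)
  refine ⟨fun l k => (hM1 l k).toSchwartzMap (hM2 l k), fun l η v => ?_⟩
  change ∑ k, M0 l k η * _ = ((ψ η : ℝ) : ℂ) * _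
  simp only [M0]
  rw [← Complex.ofReal_mul]
  simp_rw [← Complex.ofReal_mul]
  rw [← Complex.ofReal_sum]
  congr 1
  by_cases hη : η = 0
  · have := hψ0 η (by simp [hη])
    simp [this]
  · simp_rw [mul_assoc]
    rw [← Finset.mul_sum]
    congr 1
    nth_rewrite 2 [← hN' η hη v]
    nth_rewrite 2 [← w.sum_repr (symbol A η v)]
    rw [map_sum, inner_sum]
    refine Finset.sum_congr rfl fun k _ => ?_
    rw [map_smul, inner_smul_right, w.repr_apply_apply, mul_comm]

lemma aux_opApply (A : OpCoeff n 1 V W) (u : Euc n → V) (x : Euc n) :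
    opApply A u x = ∑ j, symbol A (EuclideanSpace.basisFun (Fin n) ℝ j)
      (fderiv ℝ u x (EuclideanSpace.basisFun (Fin n) ℝ j)) := by
  simp only [opApply, symbol]
  rw [← map_sum]
  congr 1
  ext e
  rw [iteratedFDeriv_one_apply, sum_apply]
  simp_rw [aux_symTensor_apply]
  nth_rewrite 1 [← (EuclideanSpace.basisFun (Fin n) ℝ).sum_repr' (e 0)]
  rw [map_sum]
  simp_rw [map_smul]

lemma aux_opApply_contDiff (A : OpCoeff n 1 V W) {u : Euc n → V} (hu : ContDiff ℝ (⊤ : ℕ∞) u) :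
    ContDiff ℝ (⊤ : ℕ∞) (opApply A u) :=
  A.contDiff.comp (hu.iteratedFDeriv_right (m := (⊤ : ℕ∞)) (i := 1) (by exact_mod_cast le_top))

lemma aux_opApply_compact (A : OpCoeff n 1 V W) {u : Euc n → V} (hu : HasCompactSupport u) :
    HasCompactSupport (opApply A u) :=
  (hu.iteratedFDeriv 1).comp_left (g := A) (map_zero A)

/-- Coordinates of a test function as a complex Schwartz function. -/
def auxCoord {U : Type*} [NormedAddCommGroup U] [InnerProductSpace ℝ U] {m : ℕ} (b : U)
    (u : Euc m → U)
    (hu : ContDiff ℝ (⊤ : ℕ∞) u) (hc : HasCompactSupport u) : 𝓢(Euc m, ℂ) :=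
  HasCompactSupport.toSchwartzMap (f := fun x => ((⟪b, u x⟫ : ℝ) : ℂ))
    (hc.comp_left (g := fun v => ((⟪b, v⟫ : ℝ) : ℂ)) (by simp))
    (Complex.ofRealCLM.contDiff.comp (contDiff_const.inner ℝ hu))

lemma auxCoord_apply {U : Type*} [NormedAddCommGroup U] [InnerProductSpace ℝ U] {m : ℕ} (b : U)
    (u : Euc m → U)
    (hu : ContDiff ℝ (⊤ : ℕ∞) u) (hc : HasCompactSupport u) (x : Euc m) :
    auxCoord b u hu hc x = ((⟪b, u x⟫ : ℝ) : ℂ) := rfl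

lemma aux_fourier {ι : Type*} [Fintype ι]
    (b : OrthonormalBasis ι ℝ V) (w : W) (A : OpCoeff n 1 V W)
    {u : Euc n → V} (hu : ContDiff ℝ (⊤ : ℕ∞) u) (hc : HasCompactSupport u) (ξ : Euc n) :
    𝓕 (auxCoord w (opApply A u) (aux_opApply_contDiff A hu) (aux_opApply_compact A hc)) ξ =
      ∑ i, (2 * Real.pi * Complex.I) * ((⟪w, symbol A ξ (b i)⟫ : ℝ) : ℂ)
        * 𝓕 (auxCoord (b i) u hu hc) ξ := by
  set e := EuclideanSpace.basisFun (Fin n) ℝ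
  have h1 : auxCoord w (opApply A u) (aux_opApply_contDiff A hu) (aux_opApply_compact A hc) =
      ∑ i, ∑ j, ((⟪w, symbol A (e j) (b i)⟫ : ℝ) : ℂ) •
        LineDeriv.lineDerivOp (e j) (auxCoord (b i) u hu hc) := by
    ext x
    rw [sum_apply]
    simp_rw [sum_apply, smul_apply,
      SchwartzMap.lineDerivOp_apply_eq_fderiv]
    have h2 : ∀ i j, fderiv ℝ (auxCoord (b i) u hu hc) x (e j) =
        ((⟪b i, fderiv ℝ u x (e j)⟫ : ℝ) : ℂ) := by
      intro i j
      have hd : HasFDerivAt u (fderiv ℝ u x) x := (hu.differentiable (by simp) x).hasFDerivAt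
      have h3 := (Complex.ofRealCLM.comp (innerSL ℝ (b i))).hasFDerivAt.comp x hd
      have h4 : HasFDerivAt (auxCoord (b i) u hu hc) _ x := h3
      rw [h4.fderiv]
      rfl
    simp_rw [h2, auxCoord_apply, aux_opApply]
    rw [inner_sum, Finset.sum_comm, Complex.ofReal_sum]
    refine Finset.sum_congr rfl fun j _ => ?_
    change ((⟪w, auxSymbolCLM A (e j) (fderiv ℝ u x (e j))⟫ : ℝ) : ℂ) = _
    nth_rewrite 1 [← b.sum_repr' (fderiv ℝ u x (e j))]
    rw [map_sum, inner_sum, Complex.ofReal_sum]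
    refine Finset.sum_congr rfl fun i _ => ?_
    rw [map_smul, inner_smul_right, Complex.ofReal_mul, mul_comm]
    rfl
  rw [h1]
  have h5 : ∀ (g : 𝓢(Euc n, ℂ)) (v : Euc n), 𝓕 (LineDeriv.lineDerivOp v g) ξ =
      (2 * Real.pi * Complex.I) * (((⟪ξ, v⟫ : ℝ) : ℂ) * 𝓕 g ξ) := by
    intro g v
    rw [SchwartzMap.fourier_lineDerivOp_eq, smul_apply,
      SchwartzMap.smulLeftCLM_apply_apply (by fun_prop)]
    simp
  have h6 : ∀ g : 𝓢(Euc n, ℂ), 𝓕 g = FourierTransform.fourierCLM ℂ 𝓢(Euc n, ℂ) g := fun _ => rfl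
  rw [h6, map_sum, sum_apply]
  simp_rw [map_sum, sum_apply, map_smul, smul_apply, ← h6, h5]
  refine Finset.sum_congr rfl fun i _ => ?_
  have h7 : symbol A ξ (b i) = ∑ j, ⟪ξ, e j⟫ • symbol A (e j) (b i) := by
    change auxSymbolCLM A ξ (b i) = ∑ j, ⟪ξ, e j⟫ • auxSymbolCLM A (e j) (b i)
    nth_rewrite 1 [← e.sum_repr' ξ]
    rw [map_sum, sum_apply]
    refine Finset.sum_congr rfl fun j _ => ?_
    rw [map_smul, real_inner_comm]
    rfl
  rw [h7, inner_sum, Complex.ofReal_sum, Finset.mul_sum, Finset.sum_mul]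
  refine Finset.sum_congr rfl fun j _ => ?_
  rw [inner_smul_right, Complex.ofReal_mul, smul_eq_mul]
  ring

/-- Partial sums of the kernel. -/
def auxKer {m : ℕ} (G : 𝓢(Euc m, ℂ)) (J : ℕ) (a : Euc m) : ℂ :=
  ∑ j ∈ Finset.range J,
    ((((2 ^ j : ℝ) * ((2 ^ j : ℝ) ^ m)⁻¹ : ℝ) : ℂ) * G ((2 ^ j : ℝ)⁻¹ • a)
      + ((((2 ^ (j + 1) : ℝ)⁻¹) * (((2 ^ (j + 1) : ℝ)⁻¹) ^ m)⁻¹ : ℝ) : ℂ) *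
          G (((2 ^ (j + 1) : ℝ)⁻¹)⁻¹ • a))

lemma aux_schwartz_bdd {m : ℕ} (G : 𝓢(Euc m, ℂ)) : ∃ C : ℝ, ∀ x, ‖G x‖ ≤ C := by
  obtain ⟨C, _, hC⟩ := G.decay 0 0
  refine ⟨C, fun x => ?_⟩
  have := hC x
  rwa [pow_zero, one_mul, norm_iteratedFDeriv_zero] at this

lemma aux_int_mul {m : ℕ} (f G : 𝓢(Euc m, ℂ)) (t : ℝ) (x : Euc m) :
    Integrable (fun z => f z * G (t • (z - x))) := by
  obtain ⟨C, hC⟩ := aux_schwartz_bdd G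
  refine f.integrable.mul_bdd (c := C) ?_ (Eventually.of_forall fun z => hC _)
  apply Continuous.aestronglyMeasurable
  fun_prop

lemma auxKer_int {m : ℕ} (f G : 𝓢(Euc m, ℂ)) (J : ℕ) (x : Euc m) :
    Integrable (fun z => f z * auxKer G J (z - x)) := by
  simp only [auxKer, Finset.mul_sum, mul_add]
  refine integrable_finsetSum _ fun j _ => Integrable.add ?_ ?_
  · simp_rw [mul_left_comm (f _)]
    exact (aux_int_mul f G _ x).const_mul _
  · simp_rw [mul_left_comm (f _)]
    exact (aux_int_mul f G _ x).const_mul _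

lemma auxKer_integral {m : ℕ} (f G : 𝓢(Euc m, ℂ)) (J : ℕ) (x : Euc m) :
    ∫ z, f z * auxKer G J (z - x) = ∑ j ∈ Finset.range J,
      (((2 ^ j : ℝ) : ℂ) *
        (∫ z, f z * ((((2 ^ j : ℝ) ^ m)⁻¹ : ℝ) * G ((2 ^ j : ℝ)⁻¹ • (z - x)))) +
      ((((2 ^ (j + 1) : ℝ)⁻¹) : ℝ) : ℂ) *
        ∫ z, f z * (((((2 ^ (j + 1) : ℝ)⁻¹) ^ m)⁻¹ : ℝ) *
          G (((2 ^ (j + 1) : ℝ)⁻¹)⁻¹ • (z - x)))) := by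
  have h : ∀ (t c d : ℝ), Integrable (fun z => f z * (((c * d : ℝ) : ℂ) * G (t • (z - x)))) := by
    intro t c d
    simp_rw [mul_left_comm (f _)]
    exact (aux_int_mul f G _ x).const_mul _
  simp only [auxKer, Finset.mul_sum, mul_add]
  rw [integral_finsetSum]
  swap
  · exact fun j _ => (h _ _ _).add (h _ _ _)
  refine Finset.sum_congr rfl fun j _ => ?_
  rw [integral_add (h _ _ _) (h _ _ _), ← integral_const_mul, ← integral_const_mul]
  congr 1 <;>
  · congr 1 with z
    push_cast
    ring

lemma aux_rep_t {ι κ : Type*} [Fintype ι] [Fintype κ]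
    (b : OrthonormalBasis ι ℝ V) (w : OrthonormalBasis κ ℝ W)
    (A : OpCoeff n 1 V W) {M : ι → κ → 𝓢(Euc n, ℂ)}
    (hM : ∀ l η v, ∑ k, M l k η * ((⟪w k, symbol A η v⟫ : ℝ) : ℂ) =
      ((auxBump n η - auxBump n ((2 : ℝ) • η) : ℝ) : ℂ) * ((⟪b l, v⟫ : ℝ) : ℂ))
    {u : Euc n → V} (hu : ContDiff ℝ (⊤ : ℕ∞) u) (hc : HasCompactSupport u)
    (l : ι) (x : Euc n) {t : ℝ} (ht : 0 < t) :
    (2 * Real.pi * Complex.I) * ∫ ξ, ((𝐞 ⟪ξ, x⟫ : Circle) : ℂ) *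
      (((auxBump n (t • ξ) - auxBump n ((2 : ℝ) • t • ξ) : ℝ) : ℂ) *
        𝓕 (auxCoord (b l) u hu hc) ξ) =
    ∑ k, (t : ℂ) * ∫ z, auxCoord (w k) (opApply A u) (aux_opApply_contDiff A hu)
      (aux_opApply_compact A hc) z *
        (((t ^ n)⁻¹ : ℝ) * 𝓕 (M l k) (t⁻¹ • (z - x))) := by
  classical
  simp_rw [← aux_swap _ _ x ht, ← integral_const_mul]
  rw [← integral_finsetSum]
  · congr 1 with ξ
    simp_rw [aux_fourier b _ A hu hc]
    have h1 : ∀ i, ∑ k, (M l k (t • ξ)) * ((t : ℂ) * ((⟪w k, symbol A ξ (b i)⟫ : ℝ) : ℂ)) =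
      ((auxBump n (t • ξ) - auxBump n ((2 : ℝ) • t • ξ) : ℝ) : ℂ) * ((⟪b l, b i⟫ : ℝ) : ℂ) := by
      intro i
      rw [← hM]
      refine Finset.sum_congr rfl fun k _ => ?_
      have : symbol A (t • ξ) (b i) = t • symbol A ξ (b i) := by
        change auxSymbolCLM A (t • ξ) (b i) = t • auxSymbolCLM A ξ (b i)
        rw [map_smul]; rfl
      rw [this, inner_smul_right, Complex.ofReal_mul]
    calc _ = ∑ i, (2 * Real.pi * Complex.I) * ((𝐞 ⟪ξ, x⟫ : Circle) : ℂ) *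
          𝓕 (auxCoord (b i) u hu hc) ξ *
          (((auxBump n (t • ξ) - auxBump n ((2 : ℝ) • t • ξ) : ℝ) : ℂ) *
            ((⟪b l, b i⟫ : ℝ) : ℂ)) := by
          rw [Finset.sum_eq_single l]
          · simp
            ring
          · intro i _ hi
            rw [b.orthonormal.2 hi.symm]
            simp
          · simp
      _ = _ := by
          simp_rw [← h1, Finset.mul_sum]
          rw [Finset.sum_comm]
          refine Finset.sum_congr rfl fun k _ => Finset.sum_congr rfl fun i _ => ?_
          ring
  · intro k _
    apply Integrable.const_mul
    have h2 : Integrable (fun ξ => M l k (t • ξ) * 𝓕 (auxCoord (w k) (opApply A u)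
        (aux_opApply_contDiff A hu) (aux_opApply_compact A hc)) ξ) := by
      simp_rw [mul_comm (M l k _)]
      simpa using aux_int_mul (𝓕 (auxCoord (w k) (opApply A u)
        (aux_opApply_contDiff A hu) (aux_opApply_compact A hc))) (M l k) t 0
    refine h2.bdd_mul (c := 1) (f := fun ξ : Euc n => ((𝐞 ⟪ξ, x⟫ : Circle) : ℂ)) ?_ ?_
    · apply Continuous.aestronglyMeasurable
      fun_prop
    · exact Eventually.of_forall fun ξ => (Circle.norm_coe _).le

lemma aux_tele {m : ℕ} (ξ : Euc m) (J : ℕ) :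
    ∑ j ∈ Finset.range J,
      ((auxBump m ((2 ^ j : ℝ) • ξ) - auxBump m ((2 : ℝ) • (2 ^ j : ℝ) • ξ)) +
       (auxBump m ((2 ^ (j + 1) : ℝ)⁻¹ • ξ) - auxBump m ((2 : ℝ) • (2 ^ (j + 1) : ℝ)⁻¹ • ξ))) =
    auxBump m ((2 ^ J : ℝ)⁻¹ • ξ) - auxBump m ((2 ^ J : ℝ) • ξ) := by
  induction J with
  | zero => simp
  | succ J ih =>
    rw [Finset.sum_range_succ, ih]
    have h1 : (2 : ℝ) • (2 ^ J : ℝ) • ξ = (2 ^ (J + 1) : ℝ) • ξ := by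
      rw [smul_smul]; congr 1; ring
    have h2 : (2 : ℝ) • (2 ^ (J + 1) : ℝ)⁻¹ • ξ = (2 ^ J : ℝ)⁻¹ • ξ := by
      rw [smul_smul]; congr 1; rw [pow_succ]; field_simp
    rw [h1, h2]
    ring

lemma aux_limit {m : ℕ} (hm : 1 < m) (g : 𝓢(Euc m, ℂ)) (x : Euc m) :
    Tendsto (fun J : ℕ => ∫ ξ, ((𝐞 ⟪ξ, x⟫ : Circle) : ℂ) *
      (((auxBump m ((2 ^ J : ℝ)⁻¹ • ξ) - auxBump m ((2 ^ J : ℝ) • ξ) : ℝ) : ℂ) * 𝓕 g ξ))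
      atTop (𝓝 (g x)) := by
  have hinv : g x = ∫ ξ, ((𝐞 ⟪ξ, x⟫ : Circle) : ℂ) * (1 * 𝓕 g ξ) := by
    have h1 : 𝓕⁻ (𝓕 g) x = g x := by rw [FourierTransform.fourierInv_fourier_eq]
    rw [← h1, SchwartzMap.fourierInv_coe, Real.fourierInv_eq]
    simp [Circle.smul_def]
  rw [hinv]
  refine tendsto_integral_of_dominated_convergence (fun ξ => ‖𝓕 g ξ‖) ?_ ?_ ?_ ?_
  · intro J
    apply Continuous.aestronglyMeasurable
    have := (auxBump m).continuous
    fun_prop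
  · exact (𝓕 g).integrable.norm
  · intro J
    refine Eventually.of_forall fun ξ => ?_
    rw [norm_mul, norm_mul, Circle.norm_coe, one_mul, Complex.norm_real, Real.norm_eq_abs]
    refine mul_le_of_le_one_left (norm_nonneg _) ?_
    have h1 := (auxBump m).nonneg (x := (2 ^ J : ℝ)⁻¹ • ξ)
    have h2 := (auxBump m).le_one (x := (2 ^ J : ℝ)⁻¹ • ξ)
    have h3 := (auxBump m).nonneg (x := (2 ^ J : ℝ) • ξ)
    have h4 := (auxBump m).le_one (x := (2 ^ J : ℝ) • ξ)
    rw [abs_le]; constructor <;> linarith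
  · have : Nonempty (Fin m) := ⟨⟨0, by omega⟩⟩
    have hne : ∀ᵐ ξ : Euc m, ξ ≠ 0 := by
      simp [ae_iff]
    filter_upwards [hne] with ξ hξ
    have hξ' : 0 < ‖ξ‖ := norm_pos_iff.2 hξ
    refine tendsto_const_nhds.congr' ?_
    have ht : Tendsto (fun J : ℕ => (2 : ℝ) ^ J) atTop atTop :=
      tendsto_pow_atTop_atTop_of_one_lt one_lt_two
    filter_upwards [ht.eventually_ge_atTop ‖ξ‖, ht.eventually_ge_atTop (2 / ‖ξ‖)] with J h1 h2
    have h3 : auxBump m ((2 ^ J : ℝ)⁻¹ • ξ) = 1 := (auxBump m).one_of_mem_closedBall (by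
      simp only [mem_closedBall, dist_zero_right]; change ‖_‖ ≤ (1 : ℝ)
      rw [norm_smul, Real.norm_of_nonneg (by positivity), inv_mul_le_iff₀ (by positivity)]
      linarith)
    have h4 : auxBump m ((2 ^ J : ℝ) • ξ) = 0 := (auxBump m).zero_of_le_dist (by
      rw [dist_zero_right]; change (2 : ℝ) ≤ _
      rw [norm_smul, Real.norm_of_nonneg (by positivity)]
      rwa [div_le_iff₀ hξ'] at h2)
    rw [h3, h4]
    simp

lemma aux_rep {ι κ : Type*} [Fintype ι] [Fintype κ] (hn : 1 < n)
    (b : OrthonormalBasis ι ℝ V) (w : OrthonormalBasis κ ℝ W)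
    (A : OpCoeff n 1 V W) {M : ι → κ → 𝓢(Euc n, ℂ)}
    (hM : ∀ l η v, ∑ k, M l k η * ((⟪w k, symbol A η v⟫ : ℝ) : ℂ) =
      ((auxBump n η - auxBump n ((2 : ℝ) • η) : ℝ) : ℂ) * ((⟪b l, v⟫ : ℝ) : ℂ))
    {u : Euc n → V} (hu : ContDiff ℝ (⊤ : ℕ∞) u) (hc : HasCompactSupport u)
    (l : ι) (x : Euc n) :
    Tendsto (fun J : ℕ => ∑ k, ∫ z, auxCoord (w k) (opApply A u) (aux_opApply_contDiff A hu)
      (aux_opApply_compact A hc) z * auxKer (𝓕 (M l k)) J (z - x)) atTop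
      (𝓝 ((2 * Real.pi * Complex.I) * ((⟪b l, u x⟫ : ℝ) : ℂ))) := by
  have h1 := (aux_limit hn (auxCoord (b l) u hu hc) x).const_mul (2 * Real.pi * Complex.I)
  rw [auxCoord_apply] at h1
  refine h1.congr fun J => ?_
  simp_rw [auxKer_integral]
  rw [Finset.sum_comm]
  simp_rw [Finset.sum_add_distrib]
  simp_rw [← aux_rep_t b w A hM hu hc l x (pow_pos two_pos _),
    ← aux_rep_t b w A hM hu hc l x (inv_pos.2 (pow_pos two_pos _))]
  have hIntg : ∀ t : ℝ, Integrable (fun ξ => ((𝐞 ⟪ξ, x⟫ : Circle) : ℂ) *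
      (((auxBump n (t • ξ) - auxBump n ((2 : ℝ) • t • ξ) : ℝ) : ℂ) *
        𝓕 (auxCoord (b l) u hu hc) ξ)) := by
    intro t
    have hcb := (auxBump n).continuous
    refine Integrable.bdd_mul (c := 1) ?_ ?_
      (Eventually.of_forall fun ξ => (Circle.norm_coe _).le)
    · refine (𝓕 (auxCoord (b l) u hu hc)).integrable.bdd_mul (c := 1) ?_
        (Eventually.of_forall fun ξ => ?_)
      · apply Continuous.aestronglyMeasurable
        fun_prop
      · rw [Complex.norm_real, Real.norm_eq_abs]
        have h1 := (auxBump n).nonneg (x := t • ξ)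
        have h2 := (auxBump n).le_one (x := t • ξ)
        have h3 := (auxBump n).nonneg (x := (2 : ℝ) • t • ξ)
        have h4 := (auxBump n).le_one (x := (2 : ℝ) • t • ξ)
        rw [abs_le]; constructor <;> linarith
    · apply Continuous.aestronglyMeasurable
      fun_prop
  rw [← Finset.sum_add_distrib]
  simp_rw [← mul_add]
  rw [← Finset.mul_sum]
  congr 1
  rw [Finset.sum_congr rfl fun j _ => (integral_add (hIntg _) (hIntg _)).symm,
    ← integral_finsetSum]
  swap
  · exact fun j _ => (hIntg _).add (hIntg _)
  congr 1 with ξ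
  rw [← aux_tele, Complex.ofReal_sum, Finset.sum_mul, Finset.mul_sum]
  refine Finset.sum_congr rfl fun j _ => ?_
  push_cast
  ring

lemma auxKer_diff {m : ℕ} (hm : 1 < m) (G : 𝓢(Euc m, ℂ)) {s β : ℝ} (hs0 : 0 < s) (hs1 : s < 1)
    (hβ : (m : ℝ) - 1 + s < β) : ∃ C : ℝ, 0 ≤ C ∧ ∀ a b : Euc m, a ≠ 0 → b ≠ 0 → ∀ J : ℕ,
      ‖auxKer G J a - auxKer G J b‖ ≤
        C * ‖a - b‖ ^ s * (1 + ‖a‖ ^ (-β) + ‖b‖ ^ (-β)) := by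
  obtain ⟨C, hC0, hC⟩ := aux_kernel_sum hm G hs0 hs1 hβ
  refine ⟨C, hC0, fun a b ha hb J => le_trans ?_ (hC a b ha hb J)⟩
  rw [auxKer, auxKer, ← Finset.sum_sub_distrib]
  refine (norm_sum_le _ _).trans (Finset.sum_le_sum fun j _ => ?_)
  rw [add_sub_add_comm, ← mul_sub, ← mul_sub]
  refine (norm_add_le _ _).trans ?_
  rw [norm_mul, norm_mul, Complex.norm_real, Complex.norm_real,
    Real.norm_of_nonneg (by positivity), Real.norm_of_nonneg (by positivity)]

lemma aux_ae_ne (hn : 1 < n) (x : Euc n) : ∀ᵐ z : Euc n, z ≠ x := by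
  have : Nonempty (Fin n) := ⟨⟨0, by omega⟩⟩
  have : Nontrivial (Euc n) := inferInstance
  exact Measure.ae_ne volume x

lemma aux_pointwise (hn : 1 < n) (A : OpCoeff n 1 V W) (hA : IsElliptic A) {s β : ℝ}
    (hs0 : 0 < s) (hs1 : s < 1) (hβ : (n : ℝ) - 1 + s < β) :
    ∃ C : ℝ, 0 ≤ C ∧ ∀ u : Euc n → V, ContDiff ℝ (⊤ : ℕ∞) u → HasCompactSupport u →
      ∀ x y : Euc n, ‖u (x + y) - u x‖ₑ ≤ ENNReal.ofReal (C * ‖y‖ ^ s) *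
        ∫⁻ z, ENNReal.ofReal (1 + ‖z - (x + y)‖ ^ (-β) + ‖z - x‖ ^ (-β)) *
          ‖opApply A u z‖ₑ := by
  set b := stdOrthonormalBasis ℝ V
  set w := stdOrthonormalBasis ℝ W
  obtain ⟨M, hM⟩ := aux_multiplier b w A hA
  choose C hC0 hC using fun l k => auxKer_diff hn (𝓕 (M l k)) hs0 hs1 hβ
  refine ⟨∑ l, ∑ k, C l k, Finset.sum_nonneg fun l _ => Finset.sum_nonneg fun k _ => hC0 l k,
    fun u hu hc x y => ?_⟩
  set I := ∫⁻ z, ENNReal.ofReal (1 + ‖z - (x + y)‖ ^ (-β) + ‖z - x‖ ^ (-β)) *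
          ‖opApply A u z‖ₑ with hI
  have key : ∀ l, ‖((⟪b l, u (x + y) - u x⟫ : ℝ) : ℂ)‖ₑ ≤
      ∑ k, ENNReal.ofReal (C l k * ‖y‖ ^ s) * I := by
    intro l
    have h1 := ((aux_rep hn b w A hM hu hc l (x + y)).sub (aux_rep hn b w A hM hu hc l x)).enorm
    have h2 : ‖((⟪b l, u (x + y) - u x⟫ : ℝ) : ℂ)‖ₑ ≤
        ‖(2 * Real.pi * Complex.I) * ((⟪b l, u (x + y)⟫ : ℝ) : ℂ) -
          (2 * Real.pi * Complex.I) * ((⟪b l, u x⟫ : ℝ) : ℂ)‖ₑ := by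
      rw [enorm_le_iff_norm_le, ← mul_sub, norm_mul, ← Complex.ofReal_sub, ← inner_sub_right]
      refine le_mul_of_one_le_left (norm_nonneg _) ?_
      simp only [norm_mul, Complex.norm_I, Complex.norm_real, Complex.norm_ofNat, mul_one,
        Real.norm_of_nonneg Real.pi_pos.le]
      linarith [Real.pi_gt_three]
    refine h2.trans (le_of_tendsto h1 (Eventually.of_forall fun J => ?_))
    rw [← Finset.sum_sub_distrib]
    refine (enorm_sum_le _ _).trans (Finset.sum_le_sum fun k _ => ?_)
    rw [← integral_sub (auxKer_int _ _ _ _) (auxKer_int _ _ _ _), hI, ← lintegral_const_mul']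
    swap
    · exact ENNReal.ofReal_ne_top
    refine (enorm_integral_le_lintegral_enorm _).trans (lintegral_mono_ae ?_)
    filter_upwards [aux_ae_ne hn (x + y), aux_ae_ne hn x] with z hz1 hz2
    rw [← mul_sub, auxCoord_apply, ← ofReal_norm, ← ofReal_norm,
      ← ENNReal.ofReal_mul (by positivity),
      ← ENNReal.ofReal_mul (mul_nonneg (hC0 l k) (by positivity))]
    apply ENNReal.ofReal_le_ofReal
    rw [norm_mul, Complex.norm_real]
    have h3 := hC l k (z - (x + y)) (z - x) (sub_ne_zero.2 hz1) (sub_ne_zero.2 hz2) J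
    have h4 : z - (x + y) - (z - x) = -y := by abel
    rw [h4, norm_neg] at h3
    have h5 : ‖(⟪w k, opApply A u z⟫ : ℝ)‖ ≤ ‖opApply A u z‖ := by
      refine (norm_inner_le_norm _ _).trans ?_
      rw [w.norm_eq_one, one_mul]
    calc _ ≤ ‖opApply A u z‖ * (C l k * ‖y‖ ^ s *
          (1 + ‖z - (x + y)‖ ^ (-β) + ‖z - x‖ ^ (-β))) := by gcongr
      _ = _ := by ring
  have h6 : ‖u (x + y) - u x‖ₑ ≤ ∑ l, ‖((⟪b l, u (x + y) - u x⟫ : ℝ) : ℂ)‖ₑ := by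
    conv_lhs => rw [← b.sum_repr' (u (x + y) - u x)]
    refine (enorm_sum_le _ _).trans (Finset.sum_le_sum fun l _ => ?_)
    rw [enorm_le_iff_norm_le, norm_smul, b.norm_eq_one, mul_one, Complex.norm_real]
  refine h6.trans ((Finset.sum_le_sum fun l _ => key l).trans ?_)
  simp_rw [← Finset.sum_mul]
  gcongr
  rw [Finset.sum_mul, ENNReal.ofReal_sum_of_nonneg]
  swap
  · exact fun l _ => mul_nonneg (Finset.sum_nonneg fun k _ => hC0 l k) (by positivity)
  refine Finset.sum_le_sum fun l _ => ?_
  rw [Finset.sum_mul, ENNReal.ofReal_sum_of_nonneg]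
  exact fun k _ => mul_nonneg (hC0 l k) (by positivity)

/-- Local integrability of the kernel. -/
lemma aux_local (hn : 1 < n) {β p : ℝ} (hp : 0 < p) (hβ : 0 ≤ β) (hβp : β * p < n) :
    ∃ I : ℝ≥0∞, I ≠ ⊤ ∧ ∀ (E : Set (Euc n)) (z : Euc n),
      ∫⁻ x in E, ENNReal.ofReal (‖z - x‖ ^ (-β)) ^ p ≤ I + volume E := by
  set g : Euc n → ℝ≥0∞ := fun x => ENNReal.ofReal (‖x‖ ^ (-β)) ^ p with hg
  have hgm : Measurable g := by fun_prop
  refine ⟨∫⁻ x in ball 0 1, g x, ?_, fun E z => ?_⟩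
  · have h1 : IntegrableOn (fun x : Euc n => ‖x‖ ^ (-(β * p))) (ball 0 1) := by
      refine integrableOn_ball_of_norm_le_rpow (C := 1) (α := β * p) ?_ ?_ ?_ ?_
      · simp only [finrank_euclideanSpace, Fintype.card_fin]; omega
      · simpa using hβp
      · refine Eventually.of_forall fun x => ?_
        rw [one_mul, Real.norm_of_nonneg (by positivity)]
      · exact Measurable.aestronglyMeasurable (by fun_prop)
    have h2 := h1.lintegral_lt_top
    refine ne_of_lt (lt_of_le_of_lt (lintegral_mono fun x => ?_) h2)
    simp only [hg]
    rw [ENNReal.ofReal_rpow_of_nonneg (by positivity) hp.le, ← Real.rpow_mul (norm_nonneg _),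
      neg_mul]
  · have h3 : ∀ x, g x ≤ (ball 0 1).indicator g x + 1 := by
      intro x
      by_cases hx : x ∈ ball (0 : Euc n) 1
      · rw [Set.indicator_of_mem hx]
        exact le_self_add
      · rw [Set.indicator_of_notMem hx, zero_add]
        have hx1 : 1 ≤ ‖x‖ := by simpa using hx
        refine ENNReal.rpow_le_one ?_ hp.le
        rw [ENNReal.ofReal_le_one]
        exact Real.rpow_le_one_of_one_le_of_nonpos hx1 (by linarith)
    calc ∫⁻ x in E, g (z - x) ≤ ∫⁻ x in E, ((ball 0 1).indicator g (z - x) + 1) :=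
          lintegral_mono fun x => h3 _
      _ = (∫⁻ x in E, (ball 0 1).indicator g (z - x)) + volume E := by
          rw [lintegral_add_right _ measurable_const, setLIntegral_one]
      _ ≤ (∫⁻ x, (ball 0 1).indicator g (z - x)) + volume E := by
          gcongr
          exact Measure.restrict_le_self
      _ = _ := by
          rw [lintegral_sub_left_eq_self (fun x => (ball 0 1).indicator g x) z,
            lintegral_indicator measurableSet_ball]

lemma aux_jensen {α : Type*} [MeasurableSpace α] (ν : Measure α) {p : ℝ} (hp : 1 ≤ p)
    {h : α → ℝ≥0∞} (hh : Measurable h) :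
    (∫⁻ z, h z ∂ν) ^ p ≤ ν Set.univ ^ (p - 1) * ∫⁻ z, h z ^ p ∂ν := by
  have h1 := eLpNorm_le_eLpNorm_mul_rpow_measure_univ (μ := ν) (p := 1) (q := ENNReal.ofReal p)
    (by simpa using hp) hh.aestronglyMeasurable
  have hp0 : 0 < p := by linarith
  rw [eLpNorm_one_eq_lintegral_enorm, eLpNorm_eq_lintegral_rpow_enorm_toReal
    (by simpa using hp0) ENNReal.ofReal_ne_top, ENNReal.toReal_ofReal hp0.le] at h1
  simp only [enorm_eq_self, ENNReal.toReal_one, div_one] at h1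
  calc _ ≤ _ := ENNReal.rpow_le_rpow h1 hp0.le
    _ = _ := by
      rw [ENNReal.mul_rpow_of_nonneg _ _ hp0.le, ← ENNReal.rpow_mul, ← ENNReal.rpow_mul, mul_comm]
      congr 2
      · field_simp
      · rw [one_div_mul_cancel hp0.ne', ENNReal.rpow_one]

lemma aux_Lp (hn : 1 < n) {β p : ℝ} (hp : 1 ≤ p) (hβ : 0 ≤ β) (hβp : β * p < n) (R : ℝ) :
    ∃ K : ℝ≥0∞, K ≠ ⊤ ∧ ∀ (f : Euc n → ℝ≥0∞), Measurable f → ∫⁻ z, f z ≠ ⊤ → ∀ y : Euc n,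
      ∫⁻ x in closedBall 0 R ∪ closedBall (-y) R,
        (∫⁻ z, ENNReal.ofReal (1 + ‖z - (x + y)‖ ^ (-β) + ‖z - x‖ ^ (-β)) * f z) ^ p
      ≤ K * (∫⁻ z, f z) ^ p := by
  have hp0 : 0 < p := by linarith
  obtain ⟨I, hI, hloc⟩ := aux_local hn hp0 hβ hβp
  set B : ℝ≥0∞ := volume (closedBall (0 : Euc n) R) + volume (closedBall (0 : Euc n) R)
  have hB : B ≠ ⊤ := ENNReal.add_ne_top.2 ⟨measure_closedBall_lt_top.ne, measure_closedBall_lt_top.ne⟩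
  set D : ℝ≥0∞ := 2 ^ (p - 1)
  have hD : D ≠ ⊤ := ENNReal.rpow_ne_top_of_nonneg (by linarith) (by simp)
  refine ⟨D * (D * (B + (I + B)) + (I + B)), ?_, fun f hf hft y => ?_⟩
  · finiteness
  set E := closedBall (0 : Euc n) R ∪ closedBall (-y) R
  have hE : volume E ≤ B := by
    refine (measure_union_le _ _).trans ?_
    exact add_le_add le_rfl (Measure.addHaar_closedBall_center volume (-y) R).le
  set ν := (volume : Measure (Euc n)).withDensity f
  have hν : ν Set.univ = ∫⁻ z, f z := by simp [ν]
  set h : Euc n → Euc n → ℝ≥0∞ := fun x z =>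
    ENNReal.ofReal (1 + ‖z - (x + y)‖ ^ (-β) + ‖z - x‖ ^ (-β))
  have hm : Measurable (Function.uncurry h) := by
    simp only [h, Function.uncurry_def]
    fun_prop
  have hk : ∀ x z, h x z ^ p ≤ D * (D * (1 + ENNReal.ofReal (‖(z - y) - x‖ ^ (-β)) ^ p) +
      ENNReal.ofReal (‖z - x‖ ^ (-β)) ^ p) := by
    intro x z
    have e : z - (x + y) = z - y - x := by abel
    simp only [h]
    rw [ENNReal.ofReal_add (by positivity) (by positivity),
      ENNReal.ofReal_add (by positivity) (by positivity), e, ENNReal.ofReal_one]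
    refine (ENNReal.rpow_add_le_mul_rpow_add_rpow _ _ hp).trans ?_
    gcongr
    refine (ENNReal.rpow_add_le_mul_rpow_add_rpow _ _ hp).trans ?_
    rw [ENNReal.one_rpow]
  have hin : ∀ z, ∫⁻ x in E, h x z ^ p ≤ D * (D * (B + (I + B)) + (I + B)) := by
    intro z
    refine (lintegral_mono fun x => hk x z).trans ?_
    rw [lintegral_const_mul' _ _ hD, lintegral_add_right _ (by fun_prop),
      lintegral_const_mul' _ _ hD, lintegral_add_right _ (by fun_prop), setLIntegral_one]
    gcongr
    · exact (hloc E _).trans (by gcongr)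
    · exact (hloc E _).trans (by gcongr)
  have hw : ∀ x, ∫⁻ z, h x z * f z = ∫⁻ z, h x z ∂ν := by
    intro x
    rw [lintegral_withDensity_eq_lintegral_mul _ hf (hm.of_uncurry_left)]
    simp [mul_comm]
  change ∫⁻ x in E, (∫⁻ z, h x z * f z) ^ p ≤ _
  simp_rw [hw]
  have hfin : ν Set.univ ≠ ⊤ := by rwa [hν]
  have : IsFiniteMeasure ν := ⟨lt_top_iff_ne_top.2 hfin⟩
  calc _ ≤ ∫⁻ x in E, ν Set.univ ^ (p - 1) * ∫⁻ z, h x z ^ p ∂ν :=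
        lintegral_mono fun x => aux_jensen ν hp hm.of_uncurry_left
    _ = ν Set.univ ^ (p - 1) * ∫⁻ x in E, ∫⁻ z, h x z ^ p ∂ν := by
        rw [lintegral_const_mul']
        exact ENNReal.rpow_ne_top_of_nonneg (by linarith) hfin
    _ = ν Set.univ ^ (p - 1) * ∫⁻ z, (∫⁻ x in E, h x z ^ p) ∂ν := by
        rw [lintegral_lintegral_swap]
        exact (hm.pow_const p).aemeasurable
    _ ≤ ν Set.univ ^ (p - 1) * ∫⁻ z, (D * (D * (B + (I + B)) + (I + B))) ∂ν := by
        gcongr with z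
        exact hin z
    _ = _ := by
        rw [lintegral_const, hν, mul_comm, mul_assoc]
        congr 1
        nth_rewrite 1 [← ENNReal.rpow_one (∫⁻ z, f z)]
        rw [← ENNReal.rpow_add_of_nonneg _ _ zero_le_one (by linarith)]
        congr 1
        ring
/-- (Nikolskiĭ-type estimate, `k = 1`.) Let `𝔸` be a first-order
elliptic operator, `R > 0`, `0 < s < 1`. For every `1 ≤ p < n/(n-1+s)` there is
`c > 0` such that for every `u ∈ C_c^∞(ℝⁿ, V)` supported in `cl B(0,R)` and every
`y ∈ ℝⁿ`, `∫ |u(x+y) − u(x)|^p dx ≤ c ‖𝔸u‖_{L¹}^p |y|^{sp}`. -/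
theorem statement15 (hn : 1 < n) (A : OpCoeff n 1 V W) (hA : IsElliptic A)
    (R : ℝ) (hR : 0 < R) (s : ℝ) (hs0 : 0 < s) (hs1 : s < 1)
    (p : ℝ) (hp1 : 1 ≤ p) (hp2 : p < (n : ℝ) / (n - 1 + s)) :
    ∃ c : ℝ, 0 < c ∧ ∀ u : Euc n → V, ContDiff ℝ (⊤ : ℕ∞) u → HasCompactSupport u →
      tsupport u ⊆ closedBall (0 : Euc n) R → ∀ y : Euc n,
        (∫ x : Euc n, ‖u (x + y) - u x‖ ^ p)
          ≤ c * (∫ x : Euc n, ‖opApply A u x‖) ^ p * ‖y‖ ^ (s * p) := by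
  have hp0 : 0 < p := by linarith
  have hn1 : (1 : ℝ) < n := by exact_mod_cast hn
  have hd : 0 < (n : ℝ) - 1 + s := by linarith
  have hnp : (n : ℝ) - 1 + s < n / p := by
    rw [lt_div_iff₀ hd] at hp2
    rw [lt_div_iff₀ hp0]
    linarith
  obtain ⟨β, hβ1, hβ2⟩ := exists_between hnp
  have hβp : β * p < n := by rwa [lt_div_iff₀ hp0] at hβ2
  obtain ⟨C, hC0, hC⟩ := aux_pointwise hn A hA hs0 hs1 hβ1
  obtain ⟨K, hK, hKb⟩ := aux_Lp (n := n) hn hp1 (by linarith : (0 : ℝ) ≤ β) hβp R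
  refine ⟨C ^ p * K.toReal + 1, by positivity, fun u hu hc hsupp y => ?_⟩
  have hAc : Continuous (opApply A u) := (aux_opApply_contDiff A hu).continuous
  have hAi : Integrable (opApply A u) :=
    hAc.integrable_of_hasCompactSupport (aux_opApply_compact A hc)
  have hAt : ∫⁻ z, ‖opApply A u z‖ₑ ≠ ⊤ := hAi.2.ne
  set L := ∫ x : Euc n, ‖opApply A u x‖ with hL
  have hL0 : 0 ≤ L := integral_nonneg fun _ => norm_nonneg _
  have hLe : ∫⁻ z, ‖opApply A u z‖ₑ = ENNReal.ofReal L := by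
    rw [hL, ofReal_integral_norm_eq_lintegral_enorm hAi]
  have huc := hu.continuous
  have hz : ∀ x, x ∉ closedBall (0 : Euc n) R → u x = 0 := fun x hx =>
    image_eq_zero_of_notMem_tsupport fun h => hx (hsupp h)
  set E := closedBall (0 : Euc n) R ∪ closedBall (-y) R with hE
  have hEm : MeasurableSet E := measurableSet_closedBall.union measurableSet_closedBall
  have h1 : ∫⁻ x, ‖u (x + y) - u x‖ₑ ^ p = ∫⁻ x in E, ‖u (x + y) - u x‖ₑ ^ p := by
    rw [← lintegral_indicator hEm]
    congr 1 with x
    by_cases hx : x ∈ E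
    · rw [Set.indicator_of_mem hx]
    · rw [Set.indicator_of_notMem hx]
      rw [hE, Set.mem_union, not_or] at hx
      have hxy : x + y ∉ closedBall (0 : Euc n) R := by
        intro h
        apply hx.2
        simpa [mem_closedBall, dist_eq_norm] using h
      rw [hz _ hxy, hz _ hx.1, sub_zero, enorm_zero, ENNReal.zero_rpow_of_pos hp0]
  have h2 : ∫⁻ x, ‖u (x + y) - u x‖ₑ ^ p ≤
      ENNReal.ofReal ((C ^ p * K.toReal) * L ^ p * ‖y‖ ^ (s * p)) := by
    rw [h1]
    calc _ ≤ ∫⁻ x in E, ENNReal.ofReal (C * ‖y‖ ^ s) ^ p *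
          (∫⁻ z, ENNReal.ofReal (1 + ‖z - (x + y)‖ ^ (-β) + ‖z - x‖ ^ (-β)) *
          ‖opApply A u z‖ₑ) ^ p := by
          refine lintegral_mono fun x => ?_
          rw [← ENNReal.mul_rpow_of_nonneg _ _ hp0.le]
          exact ENNReal.rpow_le_rpow (hC u hu hc x y) hp0.le
      _ = ENNReal.ofReal (C * ‖y‖ ^ s) ^ p * ∫⁻ x in E,
          (∫⁻ z, ENNReal.ofReal (1 + ‖z - (x + y)‖ ^ (-β) + ‖z - x‖ ^ (-β)) *
          ‖opApply A u z‖ₑ) ^ p :=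
          lintegral_const_mul' _ _
            (ENNReal.rpow_ne_top_of_nonneg hp0.le ENNReal.ofReal_ne_top)
      _ ≤ ENNReal.ofReal (C * ‖y‖ ^ s) ^ p * (K * (ENNReal.ofReal L) ^ p) := by
          rw [← hLe]
          exact mul_le_mul_right (hKb _ hAc.enorm.measurable hAt y) _
      _ = _ := by
          rw [ENNReal.ofReal_rpow_of_nonneg (by positivity) hp0.le,
            ENNReal.ofReal_rpow_of_nonneg hL0 hp0.le, Real.mul_rpow hC0 (by positivity),
            ← Real.rpow_mul (norm_nonneg y)]
          nth_rewrite 1 [← ENNReal.ofReal_toReal hK]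
          rw [← ENNReal.ofReal_mul ENNReal.toReal_nonneg, ← ENNReal.ofReal_mul (by positivity)]
          congr 1
          ring
  have h3 : ∫ x, ‖u (x + y) - u x‖ ^ p ≤ (C ^ p * K.toReal) * L ^ p * ‖y‖ ^ (s * p) := by
    rw [integral_eq_lintegral_of_nonneg_ae (Eventually.of_forall fun x => by positivity)]
    · refine ENNReal.toReal_le_of_le_ofReal (by positivity) (le_trans (le_of_eq ?_) h2)
      refine lintegral_congr fun x => ?_
      rw [← ofReal_norm, ENNReal.ofReal_rpow_of_nonneg (norm_nonneg _) hp0.le]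
    · refine Continuous.aestronglyMeasurable ?_
      exact ((huc.comp (continuous_id.add continuous_const)).sub huc).norm.rpow_const
        fun x => Or.inr hp0.le
  refine h3.trans ?_
  have : 0 ≤ L ^ p * ‖y‖ ^ (s * p) := by positivity
  nlinarith
end
end
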